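/- arXiv:2511.21144 — 2 statements merged into one kernel-verified Lean document; each statement's English description precedes it below -/
import Mathlib

section
/- n(3;7,35) = 136; that is, there exists a 3-regular simple graph with girth exactly 7 and diameter exactly 35 on 136 vertices, and every 3-regular simple graph with girth exactly 7 and diameter exactly 35 has at least 136 vertices. -/
/-- A graph is `k`-regular: every vertex has exactly `k` neighbours. -/
def IsRegular' (k : ℕ) {V : Type*} (G : SimpleGraph V) : Prop :=
  ∀ v : V, (G.neighborSet v).ncard = k

/-- A `(k; g, d)`-graph: a `k`-regular simple graph of girth exactly `g` and
diameter exactly `d`. -/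
def IsKGDGraph (k g d : ℕ) {V : Type*} (G : SimpleGraph V) : Prop :=
  IsRegular' k G ∧ G.egirth = g ∧ G.ediam = d

/-!
A search through cubic graphs of girth at least seven, layer by layer from a fixed vertex. The state
of the search is the frontier: the vertices that still have unexplored edges, each in a slot. A
matrix of at most sixteen rows of sixteen entries of sixteen bits records the distances between
them: a set bit `k < 6` of an entry shows that the distance in the explored part is at most `k`.
-/

noncomputable section
namespace LayerSearch

/-- `if b then x else y`, with a definition that the kernel evaluates lazily. -/
def pick (b x y : Bool) : Bool := Bool.rec y x b

/-- The low six bits of the sixteen entries of a row. -/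
def rowMask : ℕ := 63 * ((2 ^ 256 - 1) / 65535)
/-- The lowest bit of each of the sixteen rows. -/
def colBits : ℕ := (2 ^ 4096 - 1) / (2 ^ 256 - 1)
/-- The low six bits of the sixteen entries of a column. -/
def colMask : ℕ := 63 * colBits
/-- The low six bits of all the 256 entries of a matrix. -/
def fullMask : ℕ := 63 * ((2 ^ 4096 - 1) / 65535)
/-- The digit `4` at all the sixteen slots. -/
def fourMask : ℕ := 4 * ((2 ^ 256 - 1) / 65535)

/-- Sortable list of slots. -/
inductive Slots
  | nil
  | cons (key idx dig : ℕ) (t : Slots)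

/-- Search trees of states `(N, T, n, w)`: the matrix, the digits, the number of slots of the
frontier, and the number of vertices reached. -/
inductive STree
  | leaf
  | node (l : STree) (N T n w : ℕ) (r : STree)

open Slots STree

/-- Insertion of a slot into a list sorted by `key`, in continuation-passing style. -/
def insertSlot (k i d : ℕ) (l : Slots) : (Slots → Bool) → Bool :=
  Slots.rec (motive := fun _ => (Slots → Bool) → Bool)
    (fun c => c (cons k i d nil))
    (fun k' i' d' t ih c => pick (Nat.ble k k') (c (cons k i d (cons k' i' d' t)))
      (ih fun t' => c (cons k' i' d' t'))) l

/-- Insertion of a state into a search tree, which keeps the smallest `w` for given `(N, T, n)`. -/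
def insertTree (N T n w : ℕ) (t : STree) : (STree → Bool) → Bool :=
  STree.rec (motive := fun _ => (STree → Bool) → Bool)
    (fun c => c (node leaf N T n w leaf))
    (fun l N' T' n' w' r ihl ihr c =>
      pick (Nat.ble N N')
        (pick (Nat.beq N N')
          (pick (Nat.ble T T')
            (pick (Nat.beq T T')
              (pick (Nat.beq n n')
                (pick (Nat.ble w' w) (c (node l N' T' n' w' r)) (c (node l N' T' n' w r)))
                false)
              (ihl fun l' => c (node l' N' T' n' w' r)))
            (ihr fun r' => c (node l N' T' n' w' r')))
          (ihl fun l' => c (node l' N' T' n' w' r)))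
        (ihr fun r' => c (node l N' T' n' w' r'))) t

/-- The digit of the slot `x`: its number of unexplored edges, plus `4` if the slot lies in the next
layer. -/
def digit (T n x : ℕ) : ℕ := Nat.land (Nat.shiftRight T (Nat.mul 16 (Nat.sub (Nat.pred n) x))) 7

/-- The slots below `m` that have unexplored edges, sorted by a key. -/
def collect (P T n : ℕ) (m : ℕ) : Slots → (Slots → Bool) → Bool :=
  Nat.rec (motive := fun _ => Slots → (Slots → Bool) → Bool)
    (fun l c => c l)
    (fun i ih l c =>
      let d := digit T n i
      pick (Nat.beq (Nat.land d 3) 0) (ih l c)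
        (let k := Nat.sub (Nat.add (Nat.shiftLeft (Nat.land d 4) 14) 65535) (Nat.land
          (Nat.shiftRight P (Nat.add (Nat.mul 256 i) (Nat.mul 16 (Nat.pred n)))) 65535)
        insertSlot k i d l fun l' => ih l' c)) m

def rows (N : ℕ) (l : Slots) : ℕ :=
  Slots.rec (motive := fun _ => ℕ) 0
    (fun _ i _ _ ih => Nat.lor (Nat.shiftLeft ih 256)
      (Nat.land (Nat.shiftRight N (Nat.mul 256 i)) rowMask)) l

def cols (N : ℕ) (l : Slots) : ℕ :=
  Slots.rec (motive := fun _ => ℕ) 0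
    (fun _ i _ _ ih => Nat.lor (Nat.shiftLeft ih 16)
      (Nat.land (Nat.shiftRight N (Nat.mul 16 i)) colMask)) l

def digits (l : Slots) : ℕ → ℕ :=
  Slots.rec (motive := fun _ => ℕ → ℕ) (fun a => a)
    (fun _ _ d _ ih a => ih (Nat.add (Nat.mul a 65536) d)) l

def size (l : Slots) : ℕ :=
  Slots.rec (motive := fun _ => ℕ) 0 (fun _ _ _ _ ih => Nat.add ih 1) l

/-- Drops the slots without unexplored edges, sorts the others, and inserts the result into `t`. -/
def insertState (N T n w : ℕ) (t : STree) (c : STree → Bool) : Bool :=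
  let P := Nat.mul N T
  collect P T n n nil fun l =>
    let N₁ := rows N l
    let N₂ := cols N₁ l
    let T' := digits l 0
    let n' := size l
    pick (Nat.beq n' 0) (c t) (insertTree N₂ T' n' w t c)

def joinStep (N R s p : ℕ) : ℕ :=
  Nat.mul (Nat.land (Nat.shiftRight N (Nat.add s p)) colBits) (Nat.shiftLeft R (Nat.add p 1))

def join (N R s : ℕ) : ℕ :=
  Nat.lor (joinStep N R s 0) (Nat.lor (joinStep N R s 1) (Nat.lor (joinStep N R s 2)
    (Nat.lor (joinStep N R s 3) (joinStep N R s 4))))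

/-- The matrix after joining the slots `0` and `x` by an edge. -/
def addEdge (N x : ℕ) : ℕ :=
  let R₀ := Nat.land N rowMask
  let R := Nat.land (Nat.shiftRight N (Nat.mul 256 x)) rowMask
  Nat.land (Nat.lor N (Nat.lor (join N R 0) (join N R₀ (Nat.mul 16 x)))) fullMask

/-- The matrix after joining the slot `0` to a new slot `n`. -/
def addLeaf (N n : ℕ) : ℕ :=
  Nat.lor (Nat.lor N (Nat.shiftLeft 63 (Nat.mul 272 n)))
    (Nat.land (Nat.lor (Nat.shiftLeft (Nat.shiftLeft (Nat.land N rowMask) 1) (Nat.mul 256 n))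
      (Nat.shiftLeft (Nat.shiftLeft (Nat.land N colMask) 1) (Nat.mul 16 n))) fullMask)

/-- Joins the slot `0` to `r` new slots in the next layer. -/
def addLeaves (cap : ℕ) (nxt : STree) (c : STree → Bool) (r : ℕ) : ℕ → ℕ → ℕ → ℕ → Bool :=
  Nat.rec (motive := fun _ => ℕ → ℕ → ℕ → ℕ → Bool)
    (fun N T n w => insertState N T n w nxt c)
    (fun _ ih N T n w => pick (Nat.ble cap w) (c nxt) (pick (Nat.ble 16 n) false
      (let N' := addLeaf N n
      let T' := Nat.add (Nat.mul T 65536) 6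
      ih N' T' (Nat.succ n) (Nat.succ w)))) r

/-- Explores the `r` remaining edges at the slot `0`, which go to old slots below `k + 1` or to new
vertices. -/
def branch (cap n w k : ℕ) : ℕ → ℕ → ℕ → STree → (STree → Bool) → Bool :=
  Nat.rec (motive := fun _ => ℕ → ℕ → ℕ → STree → (STree → Bool) → Bool)
    (fun N T r nxt c => addLeaves cap nxt c r N T n w)
    (fun k ih N T r nxt c =>
      pick (Nat.beq r 0) (insertState N T n w nxt c)
        (pick (Nat.beq (Nat.land (Nat.shiftRight N (Nat.add (Nat.mul 16 k) 21)) 1) 0)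
          (let N' := addEdge N (Nat.succ k)
          let T' := Nat.sub T (Nat.shiftLeft 1 (Nat.mul 16 (Nat.sub (Nat.pred n) (Nat.succ k))))
          ih N' T' (Nat.pred r) nxt fun nxt' => ih N T r nxt' c)
          (ih N T r nxt c))) k

/-- Explores the edges at the slot `0`, or moves on to the next layer if that slot lies there. -/
def step (cap N T n w : ℕ) (nxt done : STree) (c : STree → STree → Bool) : Bool :=
  pick (Nat.ble w cap)
    (let d := digit T n 0
    pick (Nat.ble 4 d)
      (let F := Nat.shiftRight fourMask (Nat.mul 16 (Nat.sub 16 n))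
      pick (Nat.beq (Nat.land T F) F)
        (insertState N (Nat.sub T F) n w done fun done' => c nxt done') false)
      (let T' := Nat.sub T (Nat.shiftLeft d (Nat.mul 16 (Nat.pred n)))
      branch cap n w (Nat.pred n) N T' d nxt fun nxt' => c nxt' done))
    (c nxt done)

def stepAll (cap : ℕ) (t : STree) : STree → STree → (STree → STree → Bool) → Bool :=
  STree.rec (motive := fun _ => STree → STree → (STree → STree → Bool) → Bool)
    (fun nxt done c => c nxt done)
    (fun _ N T n w _ ihl ihr nxt done c => ihl nxt done fun nxt₁ done₁ =>
      step cap N T n w nxt₁ done₁ fun nxt₂ done₂ => ihr nxt₂ done₂ c) t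

def isLeaf (t : STree) : Bool := STree.rec true (fun _ _ _ _ _ _ _ _ => false) t

/-- Explores all edges that meet the current layer. -/
def layer (cap : ℕ) (fuel : ℕ) : STree → STree → (STree → Bool) → Bool :=
  Nat.rec (motive := fun _ => STree → STree → (STree → Bool) → Bool)
    (fun _ _ _ => false)
    (fun _ ih cur done c => pick (isLeaf cur) (c done)
      (stepAll cap cur leaf done fun nxt done' => ih nxt done' c)) fuel

/-- Explores one layer for each bound on the number of vertices in `caps`. -/
def run (caps : List ℕ) : STree → (STree → Bool) → Bool :=
  List.rec (motive := fun _ => STree → (STree → Bool) → Bool)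
    (fun t c => c t)
    (fun cap _ ih t c => layer cap 20 t leaf fun t' => ih t' c) caps

/-- The matrix in which only the diagonal entries are nonzero. -/
def startMatrix (n : ℕ) : ℕ :=
  Nat.rec (motive := fun _ => ℕ) 0 (fun i ih => Nat.lor ih (Nat.shiftLeft 63 (Nat.mul 272 i))) n

/-- The digits of `b` slots with two unexplored edges followed by `a` slots with one. -/
def startDigits (a b : ℕ) : ℕ :=
  Nat.rec (motive := fun _ => ℕ)
    (Nat.rec (motive := fun _ => ℕ) 0 (fun _ ih => Nat.add (Nat.mul ih 65536) 2) b)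
    (fun _ ih => Nat.add (Nat.mul ih 65536) 1) a

/-- Calls the continuation on all edgeless frontiers in a layer of at most `m` vertices. -/
def starts (m : ℕ) : STree → (STree → Bool) → Bool :=
  Nat.rec (motive := fun _ => STree → (STree → Bool) → Bool)
    (fun t c => c t)
    (fun a iha t c => Nat.rec (motive := fun _ => STree → (STree → Bool) → Bool)
      (fun t c => iha t c)
      (fun b ihb t c =>
        let N := startMatrix (Nat.add a b)
        let T := startDigits a b
        insertState N T (Nat.add a b) (Nat.add a b) t fun t' => ihb t' c)
      (Nat.sub (Nat.succ m) a) t c) (Nat.succ m)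

/-- A matrix, its digits, the number of slots, and the number of vertices. -/
abbrev State := ℕ × ℕ × ℕ × ℕ

def treeOf (S : List State) : STree :=
  List.rec (motive := fun _ => STree) leaf (fun s _ ih => node leaf s.1 s.2.1 s.2.2.1 s.2.2.2 ih) S

def mem (N T n w : ℕ) (S : List State) : Bool :=
  List.rec (motive := fun _ => Bool) false
    (fun s _ ih => pick (Nat.beq N s.1) (pick (Nat.beq T s.2.1) (pick (Nat.beq n s.2.2.1)
      (pick (Nat.ble s.2.2.2 w) true ih) ih) ih) ih) S

/-- Every state of the tree `t` occurs in `S` with at most the same weight. -/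
def covers (S : List State) (t : STree) : Bool :=
  STree.rec (motive := fun _ => Bool) true
    (fun _ N T n w _ ihl ihr => pick (mem N T n w S) (pick ihl ihr false) false) t

/-- The matrix with given rows. -/
def ofRows (D : List (List ℕ)) : ℕ :=
  D.foldr (fun R a => a * 2 ^ 256 + R.foldr (fun x b => b * 65536 + x) 0) 0

def one (w : ℕ) : State := (63, 2, 1, w)
def two (w : ℕ) : State := (ofRows [[63, 60], [60, 63]], startDigits 0 2, 2, w)
def fourRows : List (List ℕ) :=
  [[63, 60, 48, 48], [60, 63, 48, 48], [48, 48, 63, 60], [48, 48, 60, 63]]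
def four (w : ℕ) : State := (ofRows fourRows, startDigits 0 4, 4, w)
def five (w : ℕ) : State :=
  (ofRows [[63, 60, 48, 56, 48], [60, 63, 48, 48, 56], [48, 48, 63, 60, 56],
    [56, 48, 60, 63, 48], [48, 56, 56, 48, 63]], startDigits 5 0, 5, w)
def eight (w : ℕ) : State :=
  (ofRows fourRows * (1 + 2 ^ 1088), startDigits 0 8, 8, w)

/-- Every state that the search reaches from `t` is covered by a state in `S`. -/
def found (S : List State) (caps : List ℕ) (t : STree) : Bool := run caps t (covers S)

end LayerSearch
end

namespace LayerSearch
open STree Slots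

theorem pick_eq (b x y : Bool) : pick b x y = bif b then x else y := by cases b <;> rfl

def enc (d : ℕ → ℕ) : ℕ → ℕ
  | 0 => 0
  | n + 1 => enc d n * 65536 + d n

theorem enc_congr {d e : ℕ → ℕ} {n : ℕ} (h : ∀ x < n, d x = e x) : enc d n = enc e n := by
  induction n with
  | zero => rfl
  | succ n ih => simp only [enc, ih fun x hx => h x (by omega), h n (by omega)]

theorem enc_div {d : ℕ → ℕ} (hd : ∀ x, d x < 8) (x m : ℕ) :
    enc d (x + m) / 2 ^ (16 * m) = enc d x := by
  induction m with
  | zero => simp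
  | succ m ih =>
    rw [← ih, show 16 * (m + 1) = 16 + 16 * m by ring, pow_add, ← Nat.div_div_eq_div_mul,
      ← add_assoc, enc]
    congr 1
    have := hd (x + m)
    omega

theorem digit_enc {d : ℕ → ℕ} (hd : ∀ x, d x < 8) {n x : ℕ} (hx : x < n) :
    digit (enc d n) n x = d x := by
  have h : digit (enc d n) n x = (enc d n >>> (16 * (n - 1 - x))) &&& (2 ^ 3 - 1) := rfl
  rw [h, Nat.shiftRight_eq_div_pow]
  obtain ⟨m, rfl⟩ : ∃ m, n = x + 1 + m := ⟨n - (x + 1), by omega⟩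
  rw [show x + 1 + m - 1 - x = m by omega, enc_div hd, Nat.and_two_pow_sub_one_eq_mod, enc]
  have := hd x
  omega

/-- Lowering one digit. -/
theorem enc_update (d : ℕ → ℕ) {n x a : ℕ} (hx : x < n) (ha : a ≤ d x) :
    enc d n - Nat.shiftLeft a (Nat.mul 16 (Nat.sub (Nat.pred n) x)) =
      enc (Function.update d x (d x - a)) n := by
  change enc d n - a <<< (16 * (n - 1 - x)) = _
  rw [Nat.shiftLeft_eq]
  suffices enc (Function.update d x (d x - a)) n + a * 2 ^ (16 * (n - 1 - x)) = enc d n by omega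
  obtain ⟨m, rfl⟩ : ∃ m, n = x + 1 + m := ⟨n - (x + 1), by omega⟩
  rw [show x + 1 + m - 1 - x = m by omega]
  induction m with
  | zero =>
    simp only [enc, Function.update_self, mul_zero, pow_zero, mul_one]
    rw [enc_congr (e := d) fun y hy => Function.update_of_ne (by omega) _ _]
    omega
  | succ m ih =>
    have := ih (by omega)
    rw [← Nat.add_assoc (x + 1) m 1, enc, enc, ← this, Function.update_of_ne (by omega),
      mul_add 16, pow_add]
    ring

theorem enc_sub_four {d : ℕ → ℕ} {n : ℕ} (h : ∀ x < n, 4 ≤ d x) :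
    enc d n - enc (fun _ => 4) n = enc (fun x => d x - 4) n := by
  suffices enc (fun x => d x - 4) n + enc (fun _ => 4) n = enc d n by omega
  induction n with
  | zero => rfl
  | succ n ih =>
    have := ih fun x hx => h x (by omega)
    have := h n (by omega)
    simp only [enc]
    omega

theorem fourMask_shift {n : ℕ} (hn : n ≤ 16) :
    Nat.shiftRight fourMask (Nat.mul 16 (Nat.sub 16 n)) = enc (fun _ => 4) n := by
  decide +revert +kernel

theorem enc_land {d : ℕ → ℕ} (hd : ∀ x, d x < 8) {n x : ℕ} (hx : x < n)
    (h : Nat.land (enc d n) (enc (fun _ => 4) n) = enc (fun _ => 4) n) : 4 ≤ d x := by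
  have key : ∀ e : ℕ → ℕ, (∀ x, e x < 8) →
      (enc e n).testBit (16 * (n - 1 - x) + 2) = (e x).testBit 2 := by
    intro e he
    have := digit_enc he hx
    rw [← this]
    change _ = ((enc e n >>> (16 * (n - 1 - x))) &&& (2 ^ 3 - 1)).testBit 2
    simpa using fun _ => by decide
  have h2 := congrArg (Nat.testBit · (16 * (n - 1 - x) + 2)) h
  change (enc d n &&& _).testBit _ = _ at h2
  rw [Nat.testBit_and, key d hd, key _ (by simp)] at h2
  have := hd x
  generalize d x = y at *
  revert h2
  decide +revert

end LayerSearch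

namespace LayerSearch
open STree Slots

theorem beq_iff {a b : ℕ} : Nat.beq a b = true ↔ a = b := Nat.beq_eq ▸ Iff.rfl

theorem beq_false_iff {a b : ℕ} : Nat.beq a b = false ↔ a ≠ b := by
  rw [← Bool.not_eq_true, beq_iff]

def idxs : Slots → List ℕ
  | nil => []
  | cons _ i _ t => i :: idxs t

def Valid (D : ℕ → ℕ) : Slots → Prop
  | nil => True
  | cons _ i d t => d = D i ∧ Valid D t

theorem insertSlot_sound (D : ℕ → ℕ) (k i : ℕ) (l : Slots) : ∀ c : Slots → Bool,
    insertSlot k i (D i) l c = true →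
      ∃ l', c l' = true ∧ (idxs l').Perm (i :: idxs l) ∧ (Valid D l → Valid D l') := by
  induction l with
  | nil => exact fun c h => ⟨_, h, .refl _, fun _ => ⟨rfl, trivial⟩⟩
  | cons k' i' d' t ih =>
    intro c h
    change pick _ _ (insertSlot k i (D i) t _) = true at h
    rw [pick_eq] at h
    cases hk : Nat.ble k k' <;> simp only [hk, cond_true, cond_false] at h
    · obtain ⟨l', h, hp, hv⟩ := ih _ h
      exact ⟨_, h, (hp.cons i').trans (.swap _ _ _), fun v => ⟨v.1, hv v.2⟩⟩
    · exact ⟨_, h, .refl _, fun v => ⟨rfl, v⟩⟩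

theorem collect_sound (P T n m : ℕ) : ∀ (l : Slots) (c : Slots → Bool),
    collect P T n m l c = true → ∃ l', c l' = true ∧
      (idxs l').Perm ((List.range m).filter (fun i => digit T n i % 4 ≠ 0) ++ idxs l) ∧
      (Valid (digit T n) l → Valid (digit T n) l') := by
  induction m with
  | zero => exact fun l c h => ⟨l, h, by simp, id⟩
  | succ i ih =>
    intro l c h
    change pick (Nat.beq (digit T n i &&& (2 ^ 2 - 1)) 0) (collect P T n i l c)
      (insertSlot _ i (digit T n i) l fun l' => collect P T n i l' c) = true at h
    rw [pick_eq, Nat.and_two_pow_sub_one_eq_mod] at h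
    rw [List.range_succ, List.filter_append]
    by_cases hd : digit T n i % 2 ^ 2 = 0
    · rw [beq_iff.mpr hd] at h
      norm_num at hd
      simpa [hd] using ih l c h
    · rw [beq_false_iff.mpr hd, cond_false] at h
      obtain ⟨l₁, h, hp, hv⟩ := insertSlot_sound _ _ _ _ _ h
      obtain ⟨l₂, h, hp', hv'⟩ := ih _ _ h
      refine ⟨l₂, h, hp'.trans ?_, hv' ∘ hv⟩
      norm_num at hd
      simpa [hd] using hp.append_left _

theorem enc_succ' (f : ℕ → ℕ) (n : ℕ) :
    enc f (n + 1) = f 0 * 65536 ^ n + enc (fun x => f (x + 1)) n := by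
  induction n with
  | zero => simp [enc]
  | succ n ih => rw [enc, ih, enc]; ring

theorem digits_eq (D : ℕ → ℕ) (l : Slots) (hl : Valid D l) : ∀ a, digits l a =
    a * 65536 ^ (idxs l).length + enc (fun y => D ((idxs l).getD y 0)) (idxs l).length := by
  induction l with
  | nil => simp [digits, idxs, enc]
  | cons k i d t ih =>
    intro a
    change digits t (a * 65536 + d) = _
    rw [ih hl.2, hl.1]
    simp only [idxs, List.length_cons]
    rw [enc_succ']
    simp only [List.getD_cons_zero, List.getD_cons_succ]
    ring

theorem size_eq (l : Slots) : size l = (idxs l).length := by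
  induction l with
  | nil => rfl
  | cons k i d t ih => exact congrArg (· + 1) ih

theorem testBit_lt {N b m : ℕ} (h : N.testBit b = true) (hm : N >>> m = 0) : b < m := by
  by_contra! hb
  have h2 := Nat.testBit_shiftRight (i := m) (j := b - m) N
  rw [hm, Nat.zero_testBit, Nat.add_sub_cancel' hb, h] at h2
  cases h2

theorem mask_bits {N b : ℕ} {p : ℕ → Bool} (h : N.testBit b = true) (hm : N >>> 4096 = 0)
    (hp : ∀ x < 16, ∀ y < 16, ∀ z < 16, N.testBit (256 * x + 16 * y + z) = true →
      p (256 * x + 16 * y + z) = true) : b < 4096 ∧ p b = true := by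
  have hb := testBit_lt h hm
  have := hp (b / 256) (by omega) (b % 256 / 16) (by omega) (b % 16) (by omega)
  rw [show 256 * (b / 256) + 16 * (b % 256 / 16) + b % 16 = b by omega] at this
  exact ⟨hb, this h⟩

theorem rowMask_bits {b : ℕ} (h : rowMask.testBit b = true) : b < 256 ∧ b % 16 < 6 := by
  have := (mask_bits (p := fun b => b < 256 ∧ b % 16 < 6) h (by decide +kernel) (by
    decide +kernel)).2
  simpa using this

theorem colBits_bits {b : ℕ} (h : colBits.testBit b = true) : b < 4096 ∧ b % 256 = 0 := by
  simpa using mask_bits (p := fun b => b % 256 = 0) h (by decide +kernel) (by decide +kernel)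

theorem colMask_bits {b : ℕ} (h : colMask.testBit b = true) : b < 4096 ∧ b % 256 < 6 := by
  simpa using mask_bits (p := fun b => b % 256 < 6) h (by decide +kernel) (by decide +kernel)

theorem fullMask_bits {b : ℕ} (h : fullMask.testBit b = true) : b < 4096 ∧ b % 16 < 6 := by
  simpa using mask_bits (p := fun b => b % 16 < 6) h (by decide +kernel) (by decide +kernel)

theorem rows_bits (N : ℕ) (l : Slots) : ∀ b, (rows N l).testBit b = true →
    ∃ y < (idxs l).length, ∃ q < 256, b = 256 * y + q ∧ q % 16 < 6 ∧
      N.testBit (256 * (idxs l).getD y 0 + q) = true := by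
  induction l with
  | nil => intro b h; simp [rows] at h
  | cons k i d t ih =>
    intro b h
    change (rows N t <<< 256 ||| ((N >>> (256 * i)) &&& rowMask)).testBit b = true at h
    simp only [Nat.testBit_or, Nat.testBit_and, Nat.testBit_shiftLeft, Nat.testBit_shiftRight,
      Bool.or_eq_true, Bool.and_eq_true, decide_eq_true_eq] at h
    rcases h with ⟨hb, h⟩ | ⟨h, hm⟩
    · obtain ⟨y, hy, q, hq, hb', hq6, h⟩ := ih _ h
      exact ⟨y + 1, by simpa [idxs] using hy, q, hq, by omega, hq6, by simpa [idxs] using h⟩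
    · obtain ⟨hb, h6⟩ := rowMask_bits hm
      exact ⟨0, by simp [idxs], b, hb, by omega, h6, by simpa [idxs] using h⟩

theorem cols_bits (N : ℕ) (l : Slots) : ∀ b, (cols N l).testBit b = true →
    ∃ y < (idxs l).length, ∃ a, ∃ k < 6, b = 256 * a + 16 * y + k ∧
      N.testBit (256 * a + 16 * (idxs l).getD y 0 + k) = true := by
  induction l with
  | nil => intro b h; simp [cols] at h
  | cons k i d t ih =>
    intro b h
    change (cols N t <<< 16 ||| ((N >>> (16 * i)) &&& colMask)).testBit b = true at h
    simp only [Nat.testBit_or, Nat.testBit_and, Nat.testBit_shiftLeft, Nat.testBit_shiftRight,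
      Bool.or_eq_true, Bool.and_eq_true, decide_eq_true_eq] at h
    rcases h with ⟨hb, h⟩ | ⟨h, hm⟩
    · obtain ⟨y, hy, a, k, hk, hb', h⟩ := ih _ h
      exact ⟨y + 1, by simpa [idxs] using hy, a, k, hk, by omega, by simpa [idxs] using h⟩
    · obtain ⟨hb, h6⟩ := colMask_bits hm
      refine ⟨0, by simp [idxs], b / 256, b % 256, h6, by omega, ?_⟩
      convert h using 2
      simp only [idxs, List.getD_cons_zero]
      omega

/-- Every bit of `N` is the entry `(i, j)` at distance `k` of a matrix satisfying `R`. -/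
def Entries (N n : ℕ) (R : ℕ → ℕ → ℕ → Prop) : Prop :=
  ∀ b, N.testBit b = true → ∃ i < n, ∃ j < n, ∃ k < 6, b = 256 * i + 16 * j + k ∧ R i j k

def Has (Q : ℕ → ℕ → ℕ → ℕ → Prop) : STree → Prop
  | leaf => False
  | node l N T n w r => Has Q l ∨ Q N T n w ∨ Has Q r

theorem Has.mono {Q Q' : ℕ → ℕ → ℕ → ℕ → Prop} (h : ∀ N T n w, Q N T n w → Q' N T n w) :
    ∀ {t}, Has Q t → Has Q' t
  | leaf => id
  | node _ _ _ _ _ _ => Or.imp (Has.mono h) (Or.imp (h _ _ _ _) (Has.mono h))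

theorem insertTree_sound {Q : ℕ → ℕ → ℕ → ℕ → Prop}
    (hQ : ∀ N T n w w', w' ≤ w → Q N T n w → Q N T n w') (N T n w : ℕ) (t : STree) :
    ∀ c : STree → Bool, insertTree N T n w t c = true →
      ∃ t', c t' = true ∧ (Has Q t ∨ Q N T n w → Has Q t') := by
  induction t with
  | leaf => exact fun c h => ⟨_, h, by simp [Has]⟩
  | node l N' T' n' w' r ihl ihr =>
    intro c h
    have left {c : STree → Bool} {l' : STree} (h : insertTree N T n w l
        (fun l' => c (node l' N' T' n' w' r)) = true) :
        ∃ t', c t' = true ∧ (Has Q (node l N' T' n' w' r) ∨ Q N T n w → Has Q t') := by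
      obtain ⟨l', h, hl⟩ := ihl _ h
      exact ⟨_, h, by simp only [Has]; tauto⟩
    have right {c : STree → Bool} (h : insertTree N T n w r
        (fun r' => c (node l N' T' n' w' r')) = true) :
        ∃ t', c t' = true ∧ (Has Q (node l N' T' n' w' r) ∨ Q N T n w → Has Q t') := by
      obtain ⟨l', h, hl⟩ := ihr _ h
      exact ⟨_, h, by simp only [Has]; tauto⟩
    change pick (Nat.ble N N') (pick (Nat.beq N N') (pick (Nat.ble T T') (pick (Nat.beq T T')
      (pick (Nat.beq n n') (pick (Nat.ble w' w) (c (node l N' T' n' w' r))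
        (c (node l N' T' n' w r))) false)
      (insertTree N T n w l fun l' => c (node l' N' T' n' w' r)))
      (insertTree N T n w r fun r' => c (node l N' T' n' w' r')))
      (insertTree N T n w l fun l' => c (node l' N' T' n' w' r)))
      (insertTree N T n w r fun r' => c (node l N' T' n' w' r')) = true at h
    simp only [pick_eq] at h
    cases h1 : Nat.ble N N' <;> simp only [h1, cond_true, cond_false] at h
    · exact right h
    cases h2 : Nat.beq N N' <;> simp only [h2, cond_true, cond_false] at h
    · exact left (l' := leaf) h
    cases h3 : Nat.ble T T' <;> simp only [h3, cond_true, cond_false] at h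
    · exact right h
    cases h4 : Nat.beq T T' <;> simp only [h4, cond_true, cond_false] at h
    · exact left (l' := leaf) h
    cases h5 : Nat.beq n n' <;> simp only [h5, cond_true, cond_false] at h
    · cases h
    rw [beq_iff] at h2 h4 h5
    subst h2 h4 h5
    cases h6 : Nat.ble w' w <;> simp only [h6, cond_true, cond_false] at h
    · refine ⟨_, h, ?_⟩
      have := hQ N T n w' w (by rw [Bool.eq_false_iff, ne_eq, Nat.ble_eq] at h6; omega)
      simp only [Has]; tauto
    · refine ⟨_, h, ?_⟩
      have := hQ N T n w w' (by rwa [Nat.ble_eq] at h6)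
      simp only [Has]; tauto

theorem insertState_sound {Q : ℕ → ℕ → ℕ → ℕ → Prop}
    (hQ : ∀ N T n w w', w' ≤ w → Q N T n w → Q N T n w') (hQ0 : ∀ N T w, ¬ Q N T 0 w)
    {N T n w : ℕ} {t : STree} {c : STree → Bool} (h : insertState N T n w t c = true)
    {P : Prop} (hP : P → n ≤ 16 ∧ ∀ (f : ℕ → ℕ) (n' N' : ℕ), Set.InjOn f (Set.Iio n') →
      (∀ y < n', f y < n) →
      (∀ x < n, digit T n x % 4 ≠ 0 → ∃ y < n', f y = x) →
      Entries N' n' (fun i j k => N.testBit (256 * f i + 16 * f j + k) = true) →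
      Q N' (enc (fun y => digit T n (f y)) n') n' w) :
    ∃ t', c t' = true ∧ (Has Q t ∨ P → Has Q t') := by
  obtain ⟨l, h, hp, hv⟩ := collect_sound _ _ _ _ _ _ h
  change pick (Nat.beq (size l) 0) (c t) (insertTree (cols (rows N l) l) (digits l 0) (size l) w t
    c)
    = true at h
  have hv := hv trivial
  simp only [idxs, List.append_nil] at hp
  have hQl : P → Q (cols (rows N l) l) (digits l 0) (size l) w := by
    intro p
    rw [digits_eq _ _ hv, zero_mul, zero_add, size_eq]
    obtain ⟨hn, hP⟩ := hP p
    have hmem (y) (hy : y < (idxs l).length) : (idxs l).getD y 0 < n := by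
      rw [List.getD_eq_getElem _ _ hy]
      have := hp.mem_iff.mp (List.getElem_mem hy)
      simp at this
      exact this.1
    have hnd : (idxs l).Nodup := hp.nodup_iff.mpr (List.nodup_range.filter _)
    refine hP (fun y => (idxs l).getD y 0) _ _ ?_ hmem ?_ ?_
    · intro x hx y hy hxy
      simp only [Set.mem_Iio] at hx hy
      simp only [List.getD_eq_getElem _ _ hx, List.getD_eq_getElem _ _ hy] at hxy
      exact (hnd.getElem_inj_iff).mp hxy
    · intro x hx hd
      have : x ∈ idxs l := hp.mem_iff.mpr (by simp [hx, hd])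
      obtain ⟨y, hy, rfl⟩ := List.mem_iff_getElem.mp this
      exact ⟨y, hy, List.getD_eq_getElem _ _ hy⟩
    · intro b hb
      obtain ⟨y, hy, a, k, hk, hb', hr⟩ := cols_bits (rows N l) l _ hb
      obtain ⟨a', ha', q, hq, e, -, hN⟩ := rows_bits N l _ hr
      have := hmem y hy
      have : a = a' := by omega
      subst this
      refine ⟨a, ha', y, hy, k, hk, hb', ?_⟩
      convert hN using 2
      omega
  rw [pick_eq] at h
  cases h0 : Nat.beq (size l) 0 <;> simp only [h0, cond_true, cond_false] at h
  · obtain ⟨t', h, ht⟩ := insertTree_sound hQ _ _ _ _ _ _ h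
    exact ⟨t', h, fun h => ht (h.imp_right hQl)⟩
  · refine ⟨t, h, fun h => h.elim id fun p => ?_⟩
    rw [beq_iff] at h0
    exact absurd (h0 ▸ hQl p) (hQ0 _ _ _)

theorem testBit_mul {R : ℕ} (hR : R < 2 ^ 256) (C : ℕ) :
    (∀ b, C.testBit b = true → 256 ∣ b) → ∀ b, (C * R).testBit b = true →
      C.testBit (256 * (b / 256)) = true ∧ R.testBit (b % 256) = true := by
  induction C using Nat.strong_induction_on with
  | _ C ih =>
    intro hC b hb
    obtain rfl | hpos := Nat.eq_zero_or_pos C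
    · simp at hb
    have hlow : C % 2 ^ 256 = if C.testBit 0 then 1 else 0 := by
      apply Nat.eq_of_testBit_eq
      intro j
      rw [Nat.testBit_mod_two_pow]
      by_cases hj : j = 0
      · subst hj
        cases h : C.testBit 0 <;> simp
      · have : (decide (j < 256) && C.testBit j) = false := by
          rw [Bool.and_eq_false_iff, decide_eq_false_iff_not]
          by_contra! h
          have := hC j (by simpa using h.2)
          have := Nat.le_of_dvd (by omega) this
          omega
        rw [this]
        obtain ⟨j, rfl⟩ := Nat.exists_eq_succ_of_ne_zero hj
        split <;> simp [Nat.testBit_succ]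
    have hsplit : C * R = 2 ^ 256 * (C / 2 ^ 256 * R) + (C % 2 ^ 256) * R := by
      conv_lhs => rw [← Nat.div_add_mod C (2 ^ 256)]
      ring
    have hlt : C % 2 ^ 256 * R < 2 ^ 256 := by
      rw [hlow]; split
      · rwa [one_mul]
      · simp
    rw [hsplit, Nat.testBit_two_pow_mul_add _ hlt] at hb
    split at hb
    · rename_i hb'
      rw [hlow] at hb
      rw [Nat.div_eq_of_lt hb', Nat.mod_eq_of_lt hb']
      split at hb
      · rename_i h0; exact ⟨h0, by simpa using hb⟩
      · simp at hb
    · rename_i hb'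
      have := ih (C / 2 ^ 256) (Nat.div_lt_self hpos (by norm_num)) (fun j hj => by
        rw [← Nat.shiftRight_eq_div_pow, Nat.testBit_shiftRight] at hj
        have := hC _ hj
        omega) _ hb
      rw [← Nat.shiftRight_eq_div_pow, Nat.testBit_shiftRight] at this
      refine ⟨?_, ?_⟩
      · convert this.1 using 2; omega
      · convert this.2 using 2; omega

end LayerSearch

namespace LayerSearch
open SimpleGraph

structure Layering {V : Type*} (G : SimpleGraph V) (ℓ : V → ℕ) : Prop where
  adj : ∀ u v, G.Adj u v → ℓ v ≤ ℓ u + 1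
  parent : ∀ v j, ℓ v = j + 1 → ∃ u, G.Adj u v ∧ ℓ u = j
  reg : ∀ v, (G.neighborSet v).ncard = 3
  girth : ∀ u (p : G.Walk u u), p.IsCycle → 7 ≤ p.length

variable {V : Type*} {G H H' : SimpleGraph V} {ℓ : V → ℕ}

/-- The number of edges of `G` at `v` that are not in `H`. -/
noncomputable def rest (G H : SimpleGraph V) (v : V) : ℕ := {u | G.Adj v u ∧ ¬ H.Adj v u}.ncard

def Near (H : SimpleGraph V) (k : ℕ) (u v : V) : Prop := ∃ p : H.Walk u v, p.length ≤ k

theorem Near.refl (k : ℕ) (u : V) : Near H k u u := ⟨.nil, Nat.zero_le _⟩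

theorem Near.symm {k : ℕ} {u v : V} : Near H k u v → Near H k v u :=
  fun ⟨p, hp⟩ => ⟨p.reverse, by simpa⟩

theorem Near.trans {a b : ℕ} {u v w : V} : Near H a u v → Near H b v w → Near H (a + b) u w :=
  fun ⟨p, hp⟩ ⟨q, hq⟩ => ⟨p.append q, by rw [Walk.length_append]; omega⟩

theorem Near.mono {k : ℕ} {u v : V} (h : H ≤ H') : Near H k u v → Near H' k u v :=
  fun ⟨p, hp⟩ => ⟨p.mapLe h, by simpa⟩

theorem Near.of_adj {u v : V} (h : H.Adj u v) : Near H 1 u v := ⟨h.toWalk, by simp⟩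

theorem Layering.not_near (L : Layering G ℓ) (hH : H ≤ G) {u v : V} (h : G.Adj u v)
    (h' : ¬ H.Adj u v) : ¬ Near H 5 u v := by
  classical
  rintro ⟨p, hp⟩
  have hc : (Walk.cons h.symm (p.bypass.mapLe hH)).IsCycle := by
    rw [Walk.cons_isCycle_iff]
    refine ⟨(p.bypass_isPath).mapLe hH, fun he => h' ?_⟩
    rw [Walk.edges_mapLe_eq_edges] at he
    exact (Walk.adj_of_mem_edges _ he).symm
  have := L.girth _ _ hc
  have := p.length_bypass_le_length
  simp at *
  omega

theorem rest_le [Finite V] (L : Layering G ℓ) (v : V) : rest G H v ≤ 3 :=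
  L.reg v ▸ Set.ncard_le_ncard (fun _ h => h.1) (Set.toFinite _)

theorem exists_of_rest_ne_zero {v : V} (h : rest G H v ≠ 0) : ∃ u, G.Adj v u ∧ ¬ H.Adj v u :=
  Set.nonempty_of_ncard_ne_zero h

theorem rest_ne_zero [Finite V] {u v : V} (h : G.Adj v u) (h' : ¬ H.Adj v u) : rest G H v ≠ 0 :=
  Set.ncard_ne_zero_of_mem (a := u) ⟨h, h'⟩ (Set.toFinite _)

theorem rest_edge_left [Finite V] {u v : V} (h : G.Adj u v) (h' : ¬ H.Adj u v) :
    rest G (H ⊔ edge u v) u + 1 = rest G H u := by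
  rw [rest, rest, ← Set.ncard_insert_of_notMem (a := v) _ (Set.toFinite _)]
  · congr 1
    ext x
    have := h.ne
    by_cases hx : x = v
    · subst hx; simp [h, h']
    · simp [edge_adj, hx]
      tauto
  · simp [edge_adj, h.ne]

theorem rest_edge_right [Finite V] {u v : V} (h : G.Adj u v) (h' : ¬ H.Adj u v) :
    rest G (H ⊔ edge u v) v + 1 = rest G H v := by
  rw [edge_comm]
  exact rest_edge_left h.symm fun h => h' h.symm

theorem rest_edge_of_ne {u v w : V} (hu : w ≠ u) (hv : w ≠ v) :
    rest G (H ⊔ edge u v) w = rest G H w := by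
  simp [rest, edge_adj, hu, hv]

theorem rest_of_forall (L : Layering G ℓ) {u : V} (h : ∀ v, ¬ H.Adj u v) : rest G H u = 3 := by
  rw [← L.reg u, rest]
  congr 1
  ext v
  simp [h v]

noncomputable def slotDigit (G : SimpleGraph V) (ℓ : V → ℕ) (H : SimpleGraph V) (i : ℕ)
    (s : ℕ → V) (x : ℕ) : ℕ :=
  rest G H (s x) + 4 * (ℓ (s x) - i)

/-- `H` is a partial exploration of `G` whose frontier is listed by `s`. -/
structure Frontier (G : SimpleGraph V) (ℓ : V → ℕ) (H : SimpleGraph V) (i : ℕ) (s : ℕ → V)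
    (N n : ℕ) : Prop where
  le : H ≤ G
  low : ∀ u v, G.Adj u v → ¬ H.Adj u v → i ≤ ℓ u
  high : ∀ u v, H.Adj u v → ℓ u ≤ i ∨ ℓ v ≤ i
  inj : ∀ x < n, ∀ y < n, s x = s y → x = y
  range : ∀ x < n, i ≤ ℓ (s x) ∧ ℓ (s x) ≤ i + 1
  front : ∀ u, rest G H u ≠ 0 → (ℓ u = i ∨ ℓ u = i + 1 ∧ ∃ v, H.Adj u v) → ∃ x < n, s x = u
  entries : Entries N n fun a b k => Near H k (s a) (s b)
  size : n ≤ 16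

noncomputable def reached (ℓ : V → ℕ) (H : SimpleGraph V) (i : ℕ) : ℕ :=
  {u | ℓ u ≤ i ∨ ℓ u = i + 1 ∧ ∃ v, H.Adj u v}.ncard

/-- A state in the middle of exploring layer `i`. -/
def Mid (G : SimpleGraph V) (ℓ : V → ℕ) (i off N T n w : ℕ) : Prop :=
  ∃ H s, Frontier G ℓ H i s N n ∧ T = enc (slotDigit G ℓ H i s) n ∧ w + off ≤ reached ℓ H i

/-- A state before exploring layer `i`. -/
def Boundary (G : SimpleGraph V) (ℓ : V → ℕ) (i off N T n w : ℕ) : Prop :=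
  ∃ H s, Frontier G ℓ H i s N n ∧ T = enc (slotDigit G ℓ H i s) n ∧
    w + off ≤ {u | ℓ u ≤ i}.ncard

/-- A state in the middle of exploring the edges at the slot `0`, when `r` of these are left and
the slots after `k` have been treated. -/
def SplitAt (G : SimpleGraph V) (ℓ : V → ℕ) (i off N T n w r k : ℕ) (H : SimpleGraph V)
    (s : ℕ → V) : Prop :=
  Frontier G ℓ H i s N n ∧ T = enc (Function.update (slotDigit G ℓ H i s) 0 0) n ∧
    w + off ≤ reached ℓ H i ∧ 0 < n ∧ ℓ (s 0) = i ∧ r = rest G H (s 0) ∧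
    ∀ y, k < y → y < n → G.Adj (s 0) (s y) → H.Adj (s 0) (s y)

def Split (G : SimpleGraph V) (ℓ : V → ℕ) (i off N T n w r k : ℕ) : Prop :=
  ∃ H s, SplitAt G ℓ i off N T n w r k H s

theorem reached_mono [Finite V] (h : H ≤ H') (i : ℕ) : reached ℓ H i ≤ reached ℓ H' i :=
  Set.ncard_le_ncard (fun _ hu => hu.imp_right fun ⟨a, v, hv⟩ => ⟨a, v, h hv⟩) (Set.toFinite _)

theorem le_reached [Finite V] (H : SimpleGraph V) (i : ℕ) : {u | ℓ u ≤ i}.ncard ≤ reached ℓ H i :=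
  Set.ncard_le_ncard (fun _ hu => Or.inl hu) (Set.toFinite _)

theorem reached_le [Finite V] (H : SimpleGraph V) (i : ℕ) :
    reached ℓ H i ≤ {u | ℓ u ≤ i + 1}.ncard :=
  Set.ncard_le_ncard (fun _ hu => hu.elim (fun h => Nat.le_succ_of_le h) fun h => h.1.le)
    (Set.toFinite _)

theorem Boundary.mid [Finite V] {i off N T n w : ℕ} :
    Boundary G ℓ i off N T n w → Mid G ℓ i off N T n w :=
  fun ⟨H, s, hF, hT, hw⟩ => ⟨H, s, hF, hT, hw.trans (le_reached H i)⟩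

theorem slotDigit_lt [Finite V] (L : Layering G ℓ) {i : ℕ} {s : ℕ → V} {x : ℕ}
    (h : ℓ (s x) ≤ i + 1) : slotDigit G ℓ H i s x < 8 := by
  have := rest_le (H := H) L (s x)
  rw [slotDigit]; omega

theorem digit_enc' {d : ℕ → ℕ} {n x : ℕ} (hd : ∀ x < n, d x < 8) (hx : x < n) :
    digit (enc d n) n x = d x := by
  rw [enc_congr (e := fun x => d x % 8) fun x hx => (Nat.mod_eq_of_lt (hd x hx)).symm,
    digit_enc (fun x => Nat.mod_lt _ (by norm_num)) hx, Nat.mod_eq_of_lt (hd x hx)]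

section
variable [Finite V] (L : Layering G ℓ) {i off N T n w : ℕ} {s : ℕ → V}
include L

theorem Frontier.sub (hF : Frontier G ℓ H i s N n) {D : ℕ → ℕ}
    (hD : ∀ x < n, D x = slotDigit G ℓ H i s x)
    {f : ℕ → ℕ} {n' N' : ℕ} (hinj : Set.InjOn f (Set.Iio n')) (hlt : ∀ y < n', f y < n)
    (hcov : ∀ x < n, D x % 4 ≠ 0 → ∃ y < n', f y = x)
    (hent : Entries N' n' (fun i j k => N.testBit (256 * f i + 16 * f j + k) = true)) :
    Frontier G ℓ H i (s ∘ f) N' n' where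
  le := hF.le
  low := hF.low
  high := hF.high
  inj x hx y hy h := hinj hx hy (hF.inj _ (hlt x hx) _ (hlt y hy) h)
  range x hx := hF.range _ (hlt x hx)
  front u hu h := by
    obtain ⟨x, hx, rfl⟩ := hF.front u hu h
    obtain ⟨y, hy, rfl⟩ := hcov x hx (by
      rw [hD x hx, slotDigit]
      have := rest_le (H := H) L (s x)
      omega)
    exact ⟨y, hy, rfl⟩
  entries b hb := by
    obtain ⟨a, ha, c, hc, k, hk, rfl, hN⟩ := hent b hb
    refine ⟨a, ha, c, hc, k, hk, rfl, ?_⟩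
    obtain ⟨a', ha', c', hc', k', hk', e, hn⟩ := hF.entries _ hN
    have := hlt a ha
    have := hlt c hc
    have := hF.size
    obtain ⟨rfl, rfl, rfl⟩ : a' = f a ∧ c' = f c ∧ k' = k := by omega
    exact hn
  size := by
    have : (Finset.range n').card ≤ (Finset.range n).card :=
      Finset.card_le_card_of_injOn f (fun y hy => by simpa using hlt y (by simpa using hy))
        (by simpa using hinj)
    simp only [Finset.card_range] at this
    exact this.trans hF.size

theorem Frontier.pos (hF : Frontier G ℓ H i s N n) (h : ∃ u, ℓ u = i + 2) : 0 < n := by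
  obtain ⟨u, hu⟩ := h
  obtain ⟨p, hp, hpi⟩ := L.parent u (i + 1) hu
  obtain ⟨q, hq, hqi⟩ := L.parent p i hpi
  have hpu : ¬ H.Adj p u := fun h => by have := hF.high p u h; omega
  by_cases hqp : H.Adj q p
  · obtain ⟨x, hx, -⟩ := hF.front p (rest_ne_zero hp hpu) (.inr ⟨hpi, q, hqp.symm⟩)
    omega
  · obtain ⟨x, hx, -⟩ := hF.front q (rest_ne_zero hq hqp) (.inl hqi)
    omega

theorem mid_insertState (h2 : ∃ u, ℓ u = i + 2) {t : STree} {c : STree → Bool} {P : Prop}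
    (h : insertState N T n w t c = true) (hP : P → Mid G ℓ i off N T n w) :
    ∃ t', c t' = true ∧ (Has (Mid G ℓ i off) t ∨ P → Has (Mid G ℓ i off) t') := by
  refine insertState_sound (fun N T n w w' hw ⟨H, s, hF, hT, h⟩ => ⟨H, s, hF, hT, by omega⟩)
    (fun N T w ⟨H, s, hF, _⟩ => (hF.pos L h2).ne' rfl) h fun p => ?_
  obtain ⟨H, s, hF, rfl, hw⟩ := hP p
  have hd : ∀ x < n, digit (enc (slotDigit G ℓ H i s) n) n x = slotDigit G ℓ H i s x :=
    fun x hx => digit_enc' (fun x hx => slotDigit_lt L (hF.range x hx).2) hx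
  refine ⟨hF.size, fun f n' N' hinj hlt hcov hent => ⟨H, s ∘ f, hF.sub L hd hinj hlt hcov hent, ?_,
    hw⟩⟩
  exact enc_congr fun y hy => hd _ (hlt y hy)

theorem boundary_insertState (h2 : ∃ u, ℓ u = i + 2) {t : STree} {c : STree → Bool} {P : Prop}
    (h : insertState N T n w t c = true) (hP : P → Boundary G ℓ i off N T n w) :
    ∃ t', c t' = true ∧ (Has (Boundary G ℓ i off) t ∨ P → Has (Boundary G ℓ i off) t') := by
  refine insertState_sound (fun N T n w w' hw ⟨H, s, hF, hT, h⟩ => ⟨H, s, hF, hT, by omega⟩)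
    (fun N T w ⟨H, s, hF, _⟩ => (hF.pos L h2).ne' rfl) h fun p => ?_
  obtain ⟨H, s, hF, rfl, hw⟩ := hP p
  have hd : ∀ x < n, digit (enc (slotDigit G ℓ H i s) n) n x = slotDigit G ℓ H i s x :=
    fun x hx => digit_enc' (fun x hx => slotDigit_lt L (hF.range x hx).2) hx
  refine ⟨hF.size, fun f n' N' hinj hlt hcov hent => ⟨H, s ∘ f, hF.sub L hd hinj hlt hcov hent, ?_,
    hw⟩⟩
  exact enc_congr fun y hy => hd _ (hlt y hy)

end
end LayerSearch

namespace LayerSearch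
open SimpleGraph

variable {V : Type*} {G H H' : SimpleGraph V} {ℓ : V → ℕ}

theorem entries_addLeaf {s : ℕ → V} {N n : ℕ} {u : V}
    (hN : Entries N n fun a b k => Near H k (s a) (s b)) (hn : n < 16) (hH : H ≤ H')
    (hu : H'.Adj (s 0) u) :
    Entries (addLeaf N n) (n + 1) fun a b k =>
      Near H' k (Function.update s n u a) (Function.update s n u b) := by
  intro b hb
  have old : ∀ x < n, Function.update s n u x = s x :=
    fun x hx => Function.update_of_ne (by omega) _ _
  change (N ||| 63 <<< (272 * n) ||| (((N &&& rowMask) <<< 1) <<< (256 * n) |||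
    ((N &&& colMask) <<< 1) <<< (16 * n)) &&& fullMask).testBit b = true at hb
  simp only [Nat.testBit_or, Nat.testBit_and, Nat.testBit_shiftLeft,
    Bool.or_eq_true, Bool.and_eq_true, decide_eq_true_eq] at hb
  rcases hb with (hb | ⟨h1, hb⟩) | ⟨⟨h1, h2, hb, hm⟩ | ⟨h1, h2, hb, hm⟩, hf⟩
  · obtain ⟨a, ha, c, hc, k, hk, e, h⟩ := hN b hb
    exact ⟨a, by omega, c, by omega, k, hk, e, by
      beta_reduce; rw [old a ha, old c hc]; exact h.mono hH⟩
  · have : b - 272 * n < 6 := testBit_lt hb (by decide)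
    refine ⟨n, by omega, n, by omega, b - 272 * n, this, by omega, .refl _ _⟩
  · obtain ⟨a, ha, c, hc, k, hk, e, h⟩ := hN _ hb
    have := (rowMask_bits hm).1
    have := (fullMask_bits hf).2
    obtain rfl : a = 0 := by omega
    refine ⟨n, by omega, c, by omega, k + 1, by omega, by omega, ?_⟩
    beta_reduce
    rw [Function.update_self, old c hc, add_comm]
    exact (Near.of_adj hu.symm).trans (h.mono hH)
  · obtain ⟨a, ha, c, hc, k, hk, e, h⟩ := hN _ hb
    have := (colMask_bits hm).2
    have := (fullMask_bits hf).2
    obtain rfl : c = 0 := by omega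
    refine ⟨a, by omega, n, by omega, k + 1, by omega, by omega, ?_⟩
    beta_reduce
    rw [Function.update_self, old a ha]
    exact (h.mono hH).trans (Near.of_adj hu)

theorem joinStep_bits {N R c p b : ℕ} (hR : ∀ b, R.testBit b = true → b < 246)
    (hp : p < 5) (hb : (joinStep N R (16 * c) p).testBit b = true) :
    ∃ a < 16, N.testBit (256 * a + 16 * c + p) = true ∧ ∃ q, R.testBit q = true ∧
      b = 256 * a + q + p + 1 := by
  change ((N >>> (16 * c + p) &&& colBits) * (R <<< (p + 1))).testBit b = true at hb
  have hlt : R <<< (p + 1) < 2 ^ 256 := by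
    apply Nat.lt_pow_two_of_testBit
    intro j hj
    rw [Nat.testBit_shiftLeft, Bool.and_eq_false_iff, decide_eq_false_iff_not]
    by_contra! h
    have := hR _ (by simpa using h.2)
    omega
  have hC : ∀ j, (N >>> (16 * c + p) &&& colBits).testBit j = true →
      j < 4096 ∧ j % 256 = 0 ∧ N.testBit (16 * c + p + j) = true := by
    intro j hj
    simp only [Nat.testBit_and, Nat.testBit_shiftRight, Bool.and_eq_true] at hj
    have := colBits_bits hj.2
    exact ⟨this.1, this.2, hj.1⟩
  obtain ⟨h1, h2⟩ := testBit_mul hlt _ (fun j hj => Nat.dvd_of_mod_eq_zero (hC j hj).2.1) b hb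
  simp only [Nat.testBit_shiftLeft, Bool.and_eq_true, decide_eq_true_eq] at h2
  refine ⟨b / 256, by have := (hC _ h1).1; omega, ?_, _, h2.2, by omega⟩
  convert (hC _ h1).2.2 using 2
  ring

theorem join_bits {N R c b : ℕ} (hR : ∀ b, R.testBit b = true → b < 246)
    (hb : (join N R (16 * c)).testBit b = true) :
    ∃ a < 16, ∃ p < 5, N.testBit (256 * a + 16 * c + p) = true ∧ ∃ q, R.testBit q = true ∧
      b = 256 * a + q + p + 1 := by
  change (joinStep N R (16 * c) 0 ||| (joinStep N R (16 * c) 1 ||| (joinStep N R (16 * c) 2 |||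
    (joinStep N R (16 * c) 3 ||| joinStep N R (16 * c) 4)))).testBit b = true at hb
  simp only [Nat.testBit_or, Bool.or_eq_true] at hb
  obtain ⟨p, hp, hb⟩ : ∃ p < 5, (joinStep N R (16 * c) p).testBit b = true := by
    rcases hb with h | h | h | h | h
    exacts [⟨0, by norm_num, h⟩, ⟨1, by norm_num, h⟩, ⟨2, by norm_num, h⟩, ⟨3, by norm_num, h⟩,
      ⟨4, by norm_num, h⟩]
  obtain ⟨a, ha, h⟩ := joinStep_bits hR hp hb
  exact ⟨a, ha, p, hp, h⟩

theorem entries_join {s : ℕ → V} {N n c x b : ℕ}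
    (hN : Entries N n fun a b k => Near H k (s a) (s b)) (hn : n ≤ 16) (hc : c < n) (hx : x < n)
    (hH : H ≤ H') (h : H'.Adj (s c) (s x))
    (hb : (join N (N >>> (256 * x) &&& rowMask) (16 * c)).testBit b = true) (hb6 : b % 16 < 6) :
    ∃ i < n, ∃ j < n, ∃ k < 6, b = 256 * i + 16 * j + k ∧ Near H' k (s i) (s j) := by
  have hR (q : ℕ) (hq : (N >>> (256 * x) &&& rowMask).testBit q = true) :
      q < 256 ∧ q % 16 < 6 ∧ N.testBit (256 * x + q) = true := by
    simp only [Nat.testBit_and, Nat.testBit_shiftRight, Bool.and_eq_true] at hq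
    exact ⟨(rowMask_bits hq.2).1, (rowMask_bits hq.2).2, hq.1⟩
  obtain ⟨a, ha, p, hp, h1, q, hq, e⟩ := join_bits (fun q hq => by have := hR q hq; omega) hb
  obtain ⟨hq1, hq2, h2⟩ := hR q hq
  obtain ⟨a₁, ha₁, c₁, hc₁, k₁, hk₁, e₁, n₁⟩ := hN _ h1
  obtain ⟨a₂, ha₂, c₂, hc₂, k₂, hk₂, e₂, n₂⟩ := hN _ h2
  obtain ⟨rfl, rfl, rfl⟩ : a₁ = a ∧ c₁ = c ∧ k₁ = p := by omega
  obtain rfl : a₂ = x := by omega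
  refine ⟨a₁, ha₁, c₂, hc₂, k₁ + 1 + k₂, by omega, by omega, ?_⟩
  exact ((n₁.mono hH).trans (.of_adj h)).trans (n₂.mono hH)

theorem entries_addEdge {s : ℕ → V} {N n x : ℕ}
    (hN : Entries N n fun a b k => Near H k (s a) (s b)) (hn : n ≤ 16) (hx : x < n)
    (hH : H ≤ H') (h : H'.Adj (s 0) (s x)) :
    Entries (addEdge N x) n fun a b k => Near H' k (s a) (s b) := by
  intro b hb
  change ((N ||| (join N (N >>> (256 * x) &&& rowMask) 0 |||
    join N (N &&& rowMask) (16 * x))) &&& fullMask).testBit b = true at hb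
  simp only [Nat.testBit_or, Nat.testBit_and, Bool.or_eq_true, Bool.and_eq_true] at hb
  obtain ⟨hb | hb | hb, hf⟩ := hb
  · obtain ⟨a, ha, c, hc, k, hk, e, h⟩ := hN b hb
    exact ⟨a, ha, c, hc, k, hk, e, h.mono hH⟩
  · exact entries_join (c := 0) hN hn (by omega) hx hH h hb (fullMask_bits hf).2
  · exact entries_join (x := 0) hN hn hx (by omega) hH h.symm hb (fullMask_bits hf).2

section
variable [Finite V] (L : Layering G ℓ) {i off N T n w r k : ℕ}
include L

omit [Finite V] L in
theorem Split.mid (h : Split G ℓ i off N T n w 0 k) : Mid G ℓ i off N T n w := by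
  obtain ⟨H, s, hF, rfl, hw, hn, h0, hr, -⟩ := h
  refine ⟨H, s, hF, enc_congr fun x hx => ?_, hw⟩
  by_cases hx : x = 0
  · subst hx; simp [slotDigit, ← hr, h0]
  · rw [Function.update_of_ne hx]

theorem Split.addLeaf (h : Split G ℓ i off N T n w (r + 1) 0) (hn16 : n < 16) :
    Split G ℓ i off (addLeaf N n) (T * 65536 + 6) (n + 1) (w + 1) r 0 := by
  obtain ⟨H, s, hF, rfl, hw, hn, h0, hr, hadj⟩ := h
  obtain ⟨u, hu, hu'⟩ := exists_of_rest_ne_zero (hr.symm.trans_ne r.succ_ne_zero)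
  have hus : ∀ x < n, s x ≠ u := by
    rintro x hx rfl
    rcases Nat.eq_zero_or_pos x with rfl | hx0
    · exact hu.ne rfl
    · exact hu' (hadj x hx0 hx hu)
  have hrest : rest G H u ≠ 0 := rest_ne_zero hu.symm fun h => hu' h.symm
  have hle := L.adj _ _ hu
  have hge := hF.low u (s 0) hu.symm fun h => hu' h.symm
  have hlu : ℓ u = i + 1 := by
    by_contra hne
    obtain ⟨x, hx, hxu⟩ := hF.front u hrest (.inl (by omega))
    exact hus x hx hxu
  have hiso : ∀ v, ¬ H.Adj u v := fun v hv => by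
    obtain ⟨x, hx, hxu⟩ := hF.front u hrest (.inr ⟨hlu, v, hv⟩)
    exact hus x hx hxu
  have hH : H ≤ H ⊔ edge (s 0) u := le_sup_left
  have old : ∀ x < n, Function.update s n u x = s x :=
    fun x hx => Function.update_of_ne (by omega) _ _
  have hadj' : (H ⊔ edge (s 0) u).Adj (s 0) u := by simp [edge_adj, hu.ne]
  have cases' : ∀ a b, (H ⊔ edge (s 0) u).Adj a b → H.Adj a b ∨ (a = s 0 ∧ b = u) ∨
      (a = u ∧ b = s 0) := by
    intro a b h
    simp [edge_adj] at h
    tauto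
  refine ⟨H ⊔ edge (s 0) u, Function.update s n u, ⟨?_, ?_, ?_, ?_, ?_, ?_, ?_, hn16⟩, ?_, ?_,
    by omega, ?_, ?_, ?_⟩
  · exact sup_le hF.le ((edge_le_iff (G := G)).mpr (.inr hu))
  · exact fun a b h h' => hF.low a b h fun h => h' (hH h)
  · intro a b h
    rcases cases' a b h with h | ⟨rfl, rfl⟩ | ⟨rfl, rfl⟩
    · exact hF.high a b h
    · exact .inl h0.le
    · exact .inr h0.le
  · intro x hx y hy hxy
    by_cases hx' : x = n <;> by_cases hy' : y = n
    · omega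
    · subst hx'
      rw [Function.update_self, old y (by omega)] at hxy
      exact absurd hxy.symm (hus y (by omega))
    · subst hy'
      rw [Function.update_self, old x (by omega)] at hxy
      exact absurd hxy (hus x (by omega))
    · rw [old x (by omega), old y (by omega)] at hxy
      exact hF.inj x (by omega) y (by omega) hxy
  · intro x hx
    by_cases hx' : x = n
    · subst hx'; rw [Function.update_self]; omega
    · rw [old x (by omega)]; exact hF.range x (by omega)
  · intro v hv hv'
    by_cases hvu : v = u
    · exact ⟨n, by omega, by rw [Function.update_self, hvu]⟩
    by_cases hv0 : v = s 0
    · exact ⟨0, by omega, by rw [old 0 hn, hv0]⟩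
    rw [rest_edge_of_ne hv0 hvu] at hv
    obtain ⟨x, hx, hxv⟩ := hF.front v hv (hv'.imp_right fun ⟨e, y, hy⟩ => ⟨e, y, by
      rcases cases' v y hy with h | ⟨h, -⟩ | ⟨h, -⟩
      exacts [h, absurd h hv0, absurd h hvu]⟩)
    exact ⟨x, by omega, by rw [old x hx, hxv]⟩
  · exact entries_addLeaf hF.entries hn16 hH hadj'
  · rw [enc, Function.update_of_ne (by omega), slotDigit, Function.update_self, hlu]
    have : rest G (H ⊔ edge (s 0) u) u = 2 := by
      have := rest_edge_right hu hu'
      rw [rest_of_forall L hiso] at this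
      omega
    rw [this, show 2 + 4 * (i + 1 - i) = 6 by omega]
    congr 2
    refine enc_congr fun x hx => ?_
    by_cases hx0 : x = 0
    · subst hx0; simp
    rw [Function.update_of_ne hx0, Function.update_of_ne hx0, slotDigit, slotDigit, old x hx,
      rest_edge_of_ne (fun h => hx0 (hF.inj _ hx _ hn h)) (hus x hx)]
  · have hlt : reached ℓ H i < reached ℓ (H ⊔ edge (s 0) u) i := by
      refine Set.ncard_lt_ncard ⟨fun v hv => hv.imp_right fun ⟨a, y, hy⟩ => ⟨a, y, hH hy⟩, ?_⟩
        (Set.toFinite _)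
      intro h
      rcases h (show u ∈ _ from .inr ⟨hlu, _, hadj'.symm⟩) with h | ⟨-, v, hv⟩
      · omega
      · exact hiso v hv
    omega
  · rwa [old 0 hn]
  · rw [old 0 hn]
    have := rest_edge_left hu hu'
    omega
  · intro y hy hyn h
    rw [old 0 hn] at h ⊢
    by_cases hy' : y = n
    · subst hy'; rwa [Function.update_self]
    · rw [old y (by omega)] at h ⊢
      exact hH (hadj y hy (by omega) h)

omit L in
theorem SplitAt.addEdge {s : ℕ → V} (h : SplitAt G ℓ i off N T n w (r + 1) (k + 1) H s)
    (hn : k + 1 < n) (hu : G.Adj (s 0) (s (k + 1))) (hu' : ¬ H.Adj (s 0) (s (k + 1))) :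
    Split G ℓ i off (addEdge N (k + 1))
      (Nat.sub T (Nat.shiftLeft 1 (Nat.mul 16 (Nat.sub (Nat.pred n) (k + 1))))) n w r k := by
  obtain ⟨hF, rfl, hw, hn0, h0, hr, hadj⟩ := h
  set u := s (k + 1) with hsu
  have hH : H ≤ H ⊔ edge (s 0) u := le_sup_left
  have hadj' : (H ⊔ edge (s 0) u).Adj (s 0) u := by simp [edge_adj, hu.ne]
  have cases' : ∀ a b, (H ⊔ edge (s 0) u).Adj a b → H.Adj a b ∨ (a = s 0 ∧ b = u) ∨
      (a = u ∧ b = s 0) := by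
    intro a b h
    simp [edge_adj] at h
    tauto
  have hrest := rest_edge_right hu hu'
  refine ⟨H ⊔ edge (s 0) u, s, ⟨?_, ?_, ?_, hF.inj, hF.range, ?_, ?_, hF.size⟩, ?_, ?_, hn0, h0,
    ?_, ?_⟩
  · exact sup_le hF.le ((edge_le_iff (G := G)).mpr (.inr hu))
  · exact fun a b h h' => hF.low a b h fun h => h' (hH h)
  · intro a b h
    rcases cases' a b h with h | ⟨rfl, rfl⟩ | ⟨rfl, rfl⟩
    · exact hF.high a b h
    · exact .inl h0.le
    · exact .inr h0.le
  · intro v hv hv'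
    by_cases hvu : v = u
    · exact ⟨k + 1, hn, hvu.symm⟩
    by_cases hv0 : v = s 0
    · exact ⟨0, by omega, hv0.symm⟩
    rw [rest_edge_of_ne hv0 hvu] at hv
    exact hF.front v hv (hv'.imp_right fun ⟨e, y, hy⟩ => ⟨e, y, by
      rcases cases' v y hy with h | ⟨h, -⟩ | ⟨h, -⟩
      exacts [h, absurd h hv0, absurd h hvu]⟩)
  · exact entries_addEdge hF.entries hF.size hn hH hadj'
  · have hd : Function.update (slotDigit G ℓ H i s) 0 0 (k + 1) =
        rest G (H ⊔ edge (s 0) u) u + 1 + 4 * (ℓ u - i) := by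
      rw [Function.update_of_ne (by omega), slotDigit, hrest]
    change enc _ n - _ = _
    rw [enc_update _ hn (by omega), hd]
    refine enc_congr fun x hx => ?_
    by_cases hxk : x = k + 1
    · subst hxk
      rw [Function.update_self, Function.update_of_ne (by omega), slotDigit, ← hsu]
      omega
    rw [Function.update_of_ne hxk]
    by_cases hx0 : x = 0
    · subst hx0; simp
    rw [Function.update_of_ne hx0, Function.update_of_ne hx0, slotDigit, slotDigit,
      rest_edge_of_ne (fun h => hx0 (hF.inj _ hx _ hn0 h)) (fun h => hxk (hF.inj _ hx _ hn h))]
  · exact hw.trans (reached_mono hH i)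
  · have := rest_edge_left hu hu'
    omega
  · intro y hy hyn h
    by_cases hy' : y = k + 1
    · subst hy'; exact hadj'
    · exact hH (hadj y (by omega) hyn h)

end
end LayerSearch

namespace LayerSearch
open SimpleGraph STree

variable {V : Type*} {G H : SimpleGraph V} {ℓ : V → ℕ}

section
variable [Finite V] (L : Layering G ℓ) {i off cap : ℕ}
include L

theorem addLeaves_sound (h2 : ∃ u, ℓ u = i + 2) (hcap : {u | ℓ u ≤ i + 1}.ncard ≤ off + cap)
    {nxt : STree} {c : STree → Bool} (r : ℕ) : ∀ N T n w, addLeaves cap nxt c r N T n w = true →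
      ∃ t, c t = true ∧ (Has (Mid G ℓ i off) nxt ∨ Split G ℓ i off N T n w r 0 →
        Has (Mid G ℓ i off) t) := by
  induction r with
  | zero => exact fun N T n w h => mid_insertState L h2 h fun p => p.mid
  | succ r ih =>
    intro N T n w h
    change pick (Nat.ble cap w) (c nxt) (pick (Nat.ble 16 n) false
      (addLeaves cap nxt c r (addLeaf N n) (T * 65536 + 6) (n + 1) (w + 1))) = true at h
    rw [pick_eq, pick_eq] at h
    cases hw : Nat.ble cap w <;> rw [hw] at h
    · cases hn : Nat.ble 16 n <;> rw [hn] at h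
      · obtain ⟨t, h, ht⟩ := ih _ _ _ _ h
        exact ⟨t, h, fun p => ht (p.imp_right fun p => p.addLeaf L (by
          rw [← not_le, ← Nat.ble_eq]; simp [hn]))⟩
      · cases h
    · refine ⟨nxt, h, fun p => p.elim id fun ⟨H, s, p⟩ => ?_⟩
      have := Nat.le_of_ble_eq_true hw
      obtain ⟨hF, -, hw', hn0, h0, hr, hadj⟩ := p
      obtain ⟨u, hu, hu'⟩ := exists_of_rest_ne_zero (hr.symm.trans_ne r.succ_ne_zero)
      have hrest : rest G H u ≠ 0 := rest_ne_zero hu.symm fun h => hu' h.symm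
      have hus : ∀ x < n, s x ≠ u := by
        rintro x hx rfl
        rcases Nat.eq_zero_or_pos x with rfl | hx0
        · exact hu.ne rfl
        · exact hu' (hadj x hx0 hx hu)
      have hle := L.adj _ _ hu
      have hge := hF.low u (s 0) hu.symm fun h => hu' h.symm
      by_cases hlu : ℓ u = i
      · obtain ⟨x, hx, hxu⟩ := hF.front u hrest (.inl hlu)
        exact absurd hxu (hus x hx)
      have hlt : reached ℓ H i < {u | ℓ u ≤ i + 1}.ncard := by
        refine Set.ncard_lt_ncard ⟨fun v hv => hv.elim (fun h => Nat.le_succ_of_le h)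
          fun h => h.1.le, fun hs => ?_⟩ (Set.toFinite _)
        rcases hs (show u ∈ {u | ℓ u ≤ i + 1} from by
          simp only [Set.mem_ofPred_eq]; omega) with h | h
        · omega
        · obtain ⟨x, hx, hxu⟩ := hF.front u hrest (.inr h)
          exact absurd hxu (hus x hx)
      omega

theorem branch_sound (h2 : ∃ u, ℓ u = i + 2) (hcap : {u | ℓ u ≤ i + 1}.ncard ≤ off + cap)
    {n w : ℕ} (k : ℕ) : ∀ N T r nxt (c : STree → Bool), branch cap n w k N T r nxt c = true →
      ∃ t, c t = true ∧ (Has (Mid G ℓ i off) nxt ∨ k < n ∧ Split G ℓ i off N T n w r k →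
        Has (Mid G ℓ i off) t) := by
  induction k with
  | zero =>
    intro N T r nxt c h
    obtain ⟨t, h, ht⟩ := addLeaves_sound L h2 hcap r _ _ _ _ h
    exact ⟨t, h, fun p => ht (p.imp_right And.right)⟩
  | succ k ih =>
    intro N T r nxt c h
    change pick (Nat.beq r 0) (insertState N T n w nxt c)
      (pick (Nat.beq ((N >>> (16 * k + 21)) &&& (2 ^ 1 - 1)) 0)
        (branch cap n w k (addEdge N (k + 1))
          (Nat.sub T (Nat.shiftLeft 1 (Nat.mul 16 (Nat.sub (Nat.pred n) (k + 1)))))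
          (Nat.pred r) nxt fun nxt' => branch cap n w k N T r nxt' c)
        (branch cap n w k N T r nxt c)) = true at h
    rw [pick_eq, pick_eq, Nat.and_two_pow_sub_one_eq_mod] at h
    obtain _ | r := r
    · obtain ⟨t, h, ht⟩ := mid_insertState (P := Split G ℓ i off N T n w 0 (k + 1)) L h2 h
        fun p => p.mid
      exact ⟨t, h, fun p => ht (p.imp_right And.right)⟩
    rw [beq_false_iff.mpr r.succ_ne_zero, cond_false] at h
    have skip {H : SimpleGraph V} {s : ℕ → V} (p : SplitAt G ℓ i off N T n w (r + 1) (k + 1) H s)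
        (hs : G.Adj (s 0) (s (k + 1)) → H.Adj (s 0) (s (k + 1))) :
        Split G ℓ i off N T n w (r + 1) k := by
      obtain ⟨hF, hT, hw, hn, h0, hr, hadj⟩ := p
      refine ⟨H, s, hF, hT, hw, hn, h0, hr, fun y hy hyn h => ?_⟩
      by_cases hy' : y = k + 1
      · subst hy'; exact hs h
      · exact hadj y (by omega) hyn h
    by_cases hb : (N >>> (16 * k + 21)) % 2 ^ 1 = 0
    · rw [beq_iff.mpr hb, cond_true] at h
      obtain ⟨t₁, h, ht₁⟩ := ih _ _ _ _ _ h
      obtain ⟨t₂, h, ht₂⟩ := ih _ _ _ _ _ h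
      refine ⟨t₂, h, fun p => ht₂ ?_⟩
      obtain p | ⟨hk, H, s, p⟩ := p
      · exact .inl (ht₁ (.inl p))
      by_cases hs : G.Adj (s 0) (s (k + 1)) → H.Adj (s 0) (s (k + 1))
      · exact .inr ⟨by omega, skip p hs⟩
      · push Not at hs
        exact .inl (ht₁ (.inr ⟨by omega, p.addEdge hk hs.1 hs.2⟩))
    · rw [beq_false_iff.mpr hb, cond_false] at h
      obtain ⟨t, h, ht⟩ := ih _ _ _ _ _ h
      refine ⟨t, h, fun p => ht (p.imp_right fun ⟨hk, H, s, p⟩ => ⟨by omega, skip p fun hs => ?_⟩)⟩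
      by_contra hs'
      refine L.not_near p.1.le hs hs' ?_
      have hbit : N.testBit (16 * k + 21) = true := by
        rw [Nat.testBit_eq_decide_div_mod_eq, ← Nat.shiftRight_eq_div_pow, decide_eq_true_eq]
        omega
      obtain ⟨a, ha, b, hb, j, hj, e, hN⟩ := p.1.entries _ hbit
      have := p.1.size
      obtain ⟨rfl, rfl, rfl⟩ : a = 0 ∧ b = k + 1 ∧ j = 5 := by omega
      exact hN

omit [Finite V] in
theorem exists_level_pred {j : ℕ} (h : ∃ u, ℓ u = j + 1) : ∃ u, ℓ u = j :=
  let ⟨_, hu⟩ := h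
  let ⟨v, _, hv⟩ := L.parent _ _ hu
  ⟨v, hv⟩

theorem Frontier.next {s : ℕ → V} {N n : ℕ} (hF : Frontier G ℓ H i s N n)
    (h : ∀ x < n, i < ℓ (s x)) : Frontier G ℓ H (i + 1) s N n where
  le := hF.le
  low u v hu hu' := by
    refine lt_of_le_of_ne (hF.low u v hu hu') fun e => ?_
    obtain ⟨x, hx, rfl⟩ := hF.front u (rest_ne_zero hu hu') (.inl e.symm)
    exact (h x hx).ne e
  high u v hu := (hF.high u v hu).imp Nat.le_succ_of_le Nat.le_succ_of_le
  inj := hF.inj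
  range x hx := ⟨h x hx, by have := (hF.range x hx).2; omega⟩
  front u hu hu' := by
    obtain hu' | ⟨hu', v, hv⟩ := hu'
    · refine hF.front u hu (.inr ⟨hu', ?_⟩)
      obtain ⟨p, hp, hpi⟩ := L.parent u i hu'
      refine ⟨p, by_contra fun hup => ?_⟩
      obtain ⟨x, hx, rfl⟩ := hF.front p (rest_ne_zero hp fun h => hup h.symm) (.inl hpi)
      exact (h x hx).ne' hpi
    · have := hF.high u v hv
      have := L.adj v u (hF.le hv.symm)
      omega
  entries := hF.entries
  size := hF.size

theorem step_sound (h3 : ∃ u, ℓ u = i + 3) (hcap : {u | ℓ u ≤ i + 1}.ncard ≤ off + cap)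
    {N T n w : ℕ} {nxt done : STree} {c : STree → STree → Bool}
    (h : step cap N T n w nxt done c = true) :
    ∃ nxt' done', c nxt' done' = true ∧
      (Has (Boundary G ℓ (i + 1) off) done → Has (Boundary G ℓ (i + 1) off) done') ∧
      (Has (Mid G ℓ i off) nxt → Has (Mid G ℓ i off) nxt') ∧
      (Mid G ℓ i off N T n w →
        Has (Mid G ℓ i off) nxt' ∨ Has (Boundary G ℓ (i + 1) off) done') := by
  have h2 := exists_level_pred L h3
  change pick (Nat.ble w cap)
    (pick (Nat.ble 4 (digit T n 0))
      (pick (Nat.beq (Nat.land T (Nat.shiftRight fourMask (Nat.mul 16 (Nat.sub 16 n))))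
          (Nat.shiftRight fourMask (Nat.mul 16 (Nat.sub 16 n))))
        (insertState N (Nat.sub T (Nat.shiftRight fourMask (Nat.mul 16 (Nat.sub 16 n)))) n w done
          fun done' => c nxt done') false)
      (branch cap n w (Nat.pred n) N
        (Nat.sub T (Nat.shiftLeft (digit T n 0) (Nat.mul 16 (Nat.pred n)))) (digit T n 0) nxt
          fun nxt' => c nxt' done))
    (c nxt done) = true at h
  rw [pick_eq, pick_eq, pick_eq] at h
  cases hw : Nat.ble w cap
  · rw [hw, cond_false] at h
    refine ⟨nxt, done, h, id, id, fun ⟨H, s, _, _, hw'⟩ => ?_⟩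
    have := reached_le (ℓ := ℓ) H i
    have : ¬ w ≤ cap := by rw [← Nat.ble_eq, hw]; simp
    omega
  rw [hw, cond_true] at h
  have slots {H : SimpleGraph V} {s : ℕ → V} (hF : Frontier G ℓ H i s N n) :=
    fun x (hx : x < n) => slotDigit_lt (H := H) L (hF.range x hx).2
  cases h4 : Nat.ble 4 (digit T n 0)
  · rw [h4, cond_false] at h
    obtain ⟨t, h, ht⟩ := branch_sound L h2 hcap _ _ _ _ _ _ h
    refine ⟨t, done, h, id, fun h => ht (.inl h), fun ⟨H, s, hF, hT, hw'⟩ => .inl (ht (.inr ?_))⟩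
    have hn := hF.pos L h2
    have hd : digit T n 0 = slotDigit G ℓ H i s 0 := hT ▸ digit_enc' (slots hF) hn
    have h4' : ¬ 4 ≤ digit T n 0 := by rw [← Nat.ble_eq, h4]; simp
    have h0 : ℓ (s 0) = i := by
      have := (hF.range 0 hn).1
      rw [hd, slotDigit] at h4'
      omega
    refine ⟨Nat.pred_lt hn.ne', H, s, hF, ?_, hw', hn, h0, ?_, fun y hy hyn => ?_⟩
    · rw [hd, hT]
      have := enc_update (slotDigit G ℓ H i s) hn le_rfl
      rwa [Nat.sub_self] at this
    · rw [hd, slotDigit, h0]; omega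
    · rw [Nat.pred_eq_sub_one] at hy; omega
  · rw [h4, cond_true] at h
    cases hm : Nat.beq (Nat.land T (Nat.shiftRight fourMask (Nat.mul 16 (Nat.sub 16 n))))
          (Nat.shiftRight fourMask (Nat.mul 16 (Nat.sub 16 n)))
    · rw [hm] at h; cases h
    rw [hm, cond_true] at h
    obtain ⟨t, h, ht⟩ := boundary_insertState (i := i + 1) (off := off)
      (P := Mid G ℓ i off N T n w) L h3 h fun ⟨H, s, hF, hT, hw'⟩ => by
        rw [fourMask_shift hF.size, beq_iff, hT,
          enc_congr (e := fun x => slotDigit G ℓ H i s x % 8)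
            fun x hx => (Nat.mod_eq_of_lt (slots hF x hx)).symm] at hm
        have hd : ∀ x < n, 4 ≤ slotDigit G ℓ H i s x := fun x hx => by
          have := enc_land (d := fun x => slotDigit G ℓ H i s x % 8)
            (fun x => Nat.mod_lt _ (by norm_num)) hx hm
          have := slots hF x hx
          beta_reduce at *
          omega
        have hl : ∀ x < n, i < ℓ (s x) := fun x hx => by
          have := hd x hx
          have := rest_le (H := H) L (s x)
          rw [slotDigit] at *
          omega
        refine ⟨H, s, hF.next L hl, ?_, hw'.trans (reached_le H i)⟩
        rw [fourMask_shift hF.size, hT]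
        refine (enc_sub_four hd).trans (enc_congr fun x hx => ?_)
        have := hl x hx
        rw [slotDigit, slotDigit]
        omega
    exact ⟨nxt, t, h, fun h => ht (.inl h), id, fun h => .inr (ht (.inr h))⟩

theorem stepAll_sound (h3 : ∃ u, ℓ u = i + 3) (hcap : {u | ℓ u ≤ i + 1}.ncard ≤ off + cap)
    (t : STree) : ∀ (nxt done : STree) (c : STree → STree → Bool),
      stepAll cap t nxt done c = true → ∃ nxt' done', c nxt' done' = true ∧
      (Has (Boundary G ℓ (i + 1) off) done → Has (Boundary G ℓ (i + 1) off) done') ∧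
      (Has (Mid G ℓ i off) nxt → Has (Mid G ℓ i off) nxt') ∧
      (Has (Mid G ℓ i off) t →
        Has (Mid G ℓ i off) nxt' ∨ Has (Boundary G ℓ (i + 1) off) done') := by
  induction t with
  | leaf => exact fun nxt done c h => ⟨nxt, done, h, id, id, False.elim⟩
  | node l N T n w r ihl ihr =>
    intro nxt done c h
    obtain ⟨n₁, d₁, h, a₁, b₁, c₁⟩ := ihl _ _ _ h
    obtain ⟨n₂, d₂, h, a₂, b₂, c₂⟩ := step_sound L h3 hcap h
    obtain ⟨n₃, d₃, h, a₃, b₃, c₃⟩ := ihr _ _ _ h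
    refine ⟨n₃, d₃, h, fun h => a₃ (a₂ (a₁ h)), fun h => b₃ (b₂ (b₁ h)), ?_⟩
    rintro (h | h | h)
    · exact (c₁ h).imp (fun h => b₃ (b₂ h)) fun h => a₃ (a₂ h)
    · exact (c₂ h).imp b₃ a₃
    · exact c₃ h

theorem layer_sound (h3 : ∃ u, ℓ u = i + 3) (hcap : {u | ℓ u ≤ i + 1}.ncard ≤ off + cap)
    (fuel : ℕ) : ∀ (cur done : STree) (c : STree → Bool), layer cap fuel cur done c = true →
      ∃ t, c t = true ∧ (Has (Mid G ℓ i off) cur ∨ Has (Boundary G ℓ (i + 1) off) done →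
        Has (Boundary G ℓ (i + 1) off) t) := by
  induction fuel with
  | zero => intro cur done c h; cases h
  | succ f ih =>
    intro cur done c h
    change pick (isLeaf cur) (c done)
      (stepAll cap cur leaf done fun nxt done' => layer cap f nxt done' c) = true at h
    cases hl : isLeaf cur <;> rw [pick_eq, hl] at h
    rotate_left
    · cases cur
      · exact ⟨done, h, fun h => h.elim False.elim id⟩
      · cases hl
    · obtain ⟨n, d, h, a, -, b⟩ := stepAll_sound L h3 hcap _ _ _ _ h
      obtain ⟨t, h, ht⟩ := ih _ _ _ h
      exact ⟨t, h, fun p => ht (p.elim b fun p => .inr (a p))⟩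

end

/-- The layers after `i` obey the bounds `caps` on the partial sizes counted from `off`. -/
def Capped (ℓ : V → ℕ) (off : ℕ) : ℕ → List ℕ → Prop
  | _, [] => True
  | i, cap :: caps => {u | ℓ u ≤ i + 1}.ncard ≤ off + cap ∧ Capped ℓ off (i + 1) caps

theorem run_sound [Finite V] (L : Layering G ℓ) {off : ℕ} {c : STree → Bool} (caps : List ℕ) :
    ∀ (i : ℕ) (t : STree), (∃ u, ℓ u = i + caps.length + 2) → Capped ℓ off i caps →
      run caps t c = true → Has (Boundary G ℓ i off) t →
      ∃ t', c t' = true ∧ Has (Boundary G ℓ (i + caps.length) off) t' := by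
  induction caps with
  | nil => exact fun i t _ _ h ht => ⟨t, h, ht⟩
  | cons cap caps ih =>
    intro i t hu hc h ht
    have h3 : ∀ k, (∃ u, ℓ u = i + k + 3) → ∃ u, ℓ u = i + 3 := by
      intro k
      induction k with
      | zero => exact id
      | succ k ih => exact fun h => ih (exists_level_pred L h)
    change layer cap 20 t leaf (fun t' => run caps t' c) = true at h
    obtain ⟨t₁, h, ht₁⟩ := layer_sound L (h3 caps.length (by
      rw [List.length_cons] at hu; obtain ⟨u, hu⟩ := hu; exact ⟨u, by omega⟩)) hc.1 _ _ _ _ h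
    obtain ⟨t₂, h, ht₂⟩ := ih (i + 1) t₁ (by
      rw [List.length_cons] at hu; obtain ⟨u, hu⟩ := hu; exact ⟨u, by omega⟩) hc.2 h
      (ht₁ (.inl (ht.mono fun _ _ _ _ => Boundary.mid)))
    exact ⟨t₂, h, by rwa [List.length_cons, Nat.add_comm _ 1, ← Nat.add_assoc]⟩

theorem starts_sound [Finite V] (L : Layering G ℓ) {i off : ℕ} (h2 : ∃ u, ℓ u = i + 2) (m : ℕ)
    (t : STree) (c : STree → Bool) (h : starts m t c = true) :
    ∃ t', c t' = true ∧ ((∃ a b, a + b ≤ m ∧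
      Boundary G ℓ i off (startMatrix (a + b)) (startDigits a b) (a + b) (a + b)) →
        Has (Boundary G ℓ i off) t') := by
  let B a b := Boundary G ℓ i off (startMatrix (a + b)) (startDigits a b) (a + b) (a + b)
  let F (a : ℕ) (ih : STree → (STree → Bool) → Bool) (k : ℕ) : STree → (STree → Bool) → Bool :=
    Nat.rec (motive := fun _ => STree → (STree → Bool) → Bool)
      (fun t c => ih t c)
      (fun b ihb t c => insertState (startMatrix (a + b)) (startDigits a b) (a + b) (a + b) t
        fun t' => ihb t' c) k
  have inner (a : ℕ) (ih : STree → (STree → Bool) → Bool) (k : ℕ) : ∀ (t : STree)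
      (c : STree → Bool), F a ih k t c = true → ∃ t', ih t' c = true ∧
        (Has (Boundary G ℓ i off) t ∨ (∃ b < k, B a b) → Has (Boundary G ℓ i off) t') := by
    induction k with
    | zero => exact fun t c h => ⟨t, h, by simp⟩
    | succ k ihk =>
      intro t c h
      obtain ⟨t₁, h, ht₁⟩ := boundary_insertState L h2 h (id : B a k → B a k)
      obtain ⟨t₂, h, ht₂⟩ := ihk _ _ h
      refine ⟨t₂, h, ?_⟩
      rintro (p | ⟨b, hb, p⟩)
      · exact ht₂ (.inl (ht₁ (.inl p)))
      · rcases Nat.lt_succ_iff_lt_or_eq.mp hb with hb | rfl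
        · exact ht₂ (.inr ⟨b, hb, p⟩)
        · exact ht₂ (.inl (ht₁ (.inr p)))
  let O (k : ℕ) : STree → (STree → Bool) → Bool :=
    Nat.rec (motive := fun _ => STree → (STree → Bool) → Bool) (fun t c => c t)
      (fun a iha t c => F a iha (m + 1 - a) t c) k
  have outer (k : ℕ) : ∀ (t : STree) (c : STree → Bool), O k t c = true → ∃ t', c t' = true ∧
      (Has (Boundary G ℓ i off) t ∨ (∃ a < k, ∃ b < m + 1 - a, B a b) →
        Has (Boundary G ℓ i off) t') := by
    induction k with
    | zero => exact fun t c h => ⟨t, h, by simp⟩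
    | succ k ihk =>
      intro t c h
      obtain ⟨t₁, h, ht₁⟩ := inner k (O k) _ t c h
      obtain ⟨t₂, h, ht₂⟩ := ihk _ _ h
      refine ⟨t₂, h, ?_⟩
      rintro (p | ⟨a, ha, p⟩)
      · exact ht₂ (.inl (ht₁ (.inl p)))
      · rcases Nat.lt_succ_iff_lt_or_eq.mp ha with ha | rfl
        · exact ht₂ (.inr ⟨a, ha, p⟩)
        · exact ht₂ (.inl (ht₁ (.inr p)))
  obtain ⟨t', h, ht⟩ := outer (m + 1) t c h
  exact ⟨t', h, fun ⟨a, b, hab, h⟩ => ht (.inr ⟨a, by omega, b, by omega, h⟩)⟩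

theorem covers_sound {Q : ℕ → ℕ → ℕ → ℕ → Prop}
    (hQ : ∀ N T n w w', w' ≤ w → Q N T n w → Q N T n w') {S : List State} {t : STree}
    (h : covers S t = true) (ht : Has Q t) : ∃ s ∈ S, Q s.1 s.2.1 s.2.2.1 s.2.2.2 := by
  have mem_sound {N T n w : ℕ} (hq : Q N T n w) :
      ∀ S : List State, mem N T n w S = true → ∃ s ∈ S, Q s.1 s.2.1 s.2.2.1 s.2.2.2 := by
    intro S
    induction S with
    | nil => intro h; cases h
    | cons s S ih =>
      intro h
      change pick (Nat.beq N s.1) (pick (Nat.beq T s.2.1) (pick (Nat.beq n s.2.2.1)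
        (pick (Nat.ble s.2.2.2 w) true (mem N T n w S)) (mem N T n w S)) (mem N T n w S))
        (mem N T n w S) = true at h
      simp only [pick_eq] at h
      by_cases h' : mem N T n w S = true
      · obtain ⟨s', hs, h⟩ := ih h'
        exact ⟨s', List.mem_cons_of_mem _ hs, h⟩
      · refine ⟨s, List.mem_cons_self, ?_⟩
        rw [Bool.not_eq_true] at h'
        simp only [h', Bool.cond_false_right, Bool.and_true, Bool.and_eq_true, beq_iff,
          Nat.ble_eq] at h
        obtain ⟨rfl, rfl, rfl, h⟩ := h
        exact hQ _ _ _ _ _ h hq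
  induction t with
  | leaf => exact ht.elim
  | node l N T n w r ihl ihr =>
    change pick (mem N T n w S) (pick (covers S l) (covers S r) false) false = true at h
    simp only [pick_eq, Bool.cond_false_right, Bool.and_eq_true] at h
    obtain ⟨h1, h2, h3⟩ := h
    rcases ht with h | h | h
    exacts [ihl h2 h, mem_sound h S h1, ihr h3 h]

theorem Has.treeOf {Q : ℕ → ℕ → ℕ → ℕ → Prop} {S : List State}
    (h : ∃ s ∈ S, Q s.1 s.2.1 s.2.2.1 s.2.2.2) : Has Q (treeOf S) := by
  induction S with
  | nil => simp at h
  | cons s S ih =>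
    obtain ⟨s', hs, h⟩ := h
    rcases List.mem_cons.mp hs with rfl | hs
    · exact .inr (.inl h)
    · exact .inr (.inr (ih ⟨s', hs, h⟩))

theorem found_sound [Finite V] (L : Layering G ℓ) {i off : ℕ} {S : List State} {caps : List ℕ}
    {t : STree} (h : found S caps t = true) (hu : ∃ u, ℓ u = i + caps.length + 2)
    (hc : Capped ℓ off i caps) (ht : Has (Boundary G ℓ i off) t) :
    ∃ s ∈ S, Boundary G ℓ (i + caps.length) off s.1 s.2.1 s.2.2.1 s.2.2.2 := by
  obtain ⟨t', h, ht'⟩ := run_sound L caps i t hu hc h ht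
  exact covers_sound (fun N T n w w' hw ⟨H, s, hF, hT, h⟩ => ⟨H, s, hF, hT, by omega⟩) h ht'

end LayerSearch

namespace LayerSearch

theorem run_two : starts 1 .leaf (found [one 2] [2]) = true := by decide +kernel

theorem run_three : starts 3 .leaf (found [one 4, two 4] [4, 5]) = true := by decide +kernel

theorem run_four : starts 4 .leaf (found [one 8, two 6, four 8] [6, 7, 8]) = true := by
  decide +kernel

theorem run_five : starts 6 .leaf (found [two 10, four 10, one 12] [7, 10, 11, 12]) = true := by
  decide +kernel

theorem run_six : starts 6 .leaf (found [four 14, two 15, one 15] [8, 10, 14, 15, 16]) = true := by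
  decide +kernel

theorem run_seven : starts 6 .leaf (found [five 23, eight 22] [10, 14, 17, 20, 22, 23]) = true := by
  decide +kernel

theorem run_seven_more : found [eight 46] [29, 33, 37, 40, 44, 45, 46]
    (treeOf [five 23, eight 22, four 21, two 21, one 22]) = true := by
  decide +kernel

theorem run_seven_tight : found [two 45, four 45] [31, 35, 39, 41, 43, 44, 45]
    (treeOf [four 21, two 21, one 22]) = true := by
  decide +kernel

theorem run_min_three : starts 1 .leaf (found [] [2, 3]) = true := by decide +kernel

theorem run_min_four : starts 1 .leaf (found [] [3, 4, 5]) = true := by decide +kernel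

theorem run_min_five : starts 3 .leaf (found [] [5, 7, 8, 9]) = true := by decide +kernel

theorem run_min_six : starts 3 .leaf (found [] [7, 9, 11, 12, 13]) = true := by decide +kernel

theorem run_ball : found [] [21, 21, 21] (.node .leaf 63 3 1 1 .leaf) = true := by decide +kernel

end LayerSearch

namespace LayerSearch
open SimpleGraph STree

variable {V : Type*} {G H : SimpleGraph V} {ℓ : V → ℕ}

theorem startMatrix_bits {n b : ℕ} (h : (startMatrix n).testBit b = true) :
    ∃ x < n, ∃ k < 6, b = 256 * x + 16 * x + k := by
  induction n with
  | zero => simp [startMatrix] at h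
  | succ n ih =>
    change (startMatrix n ||| 63 <<< (272 * n)).testBit b = true at h
    simp only [Nat.testBit_or, Nat.testBit_shiftLeft, Bool.or_eq_true, Bool.and_eq_true,
      decide_eq_true_eq] at h
    rcases h with h | ⟨h1, h⟩
    · obtain ⟨x, hx, k, hk, e⟩ := ih h
      exact ⟨x, by omega, k, hk, e⟩
    · have : b - 272 * n < 6 := testBit_lt h (by decide)
      exact ⟨n, by omega, b - 272 * n, this, by omega⟩

theorem startDigits_eq (a b : ℕ) :
    startDigits a b = enc (fun x => if x < b then 2 else 1) (a + b) := by
  induction a with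
  | zero =>
    rw [Nat.zero_add, enc_congr (e := fun _ => 2) fun x hx => by simp [hx]]
    induction b with
    | zero => rfl
    | succ b ih => rw [enc, ← ih]; rfl
  | succ a ih =>
    rw [Nat.add_right_comm, enc, ← ih]
    simp
    rfl

/-- The edges that meet a layer before `i`. -/
def inner (G : SimpleGraph V) (ℓ : V → ℕ) (i : ℕ) : SimpleGraph V where
  Adj u v := G.Adj u v ∧ (ℓ u < i ∨ ℓ v < i)
  symm := ⟨fun _ _ h => ⟨h.1.symm, h.2.symm⟩⟩
  loopless := ⟨fun _ h => h.1.ne rfl⟩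

theorem exists_boundary_start [Finite V] (L : Layering G ℓ) {i m : ℕ} (hm : m ≤ 16)
    (hi : {u | ℓ u ≤ i + 1}.ncard ≤ {u | ℓ u ≤ i}.ncard + m) (h : ∃ u, ℓ u = i + 1) :
    ∃ a b, a + b ≤ m ∧ Boundary G ℓ (i + 1) {u | ℓ u ≤ i}.ncard (startMatrix (a + b))
      (startDigits a b) (a + b) (a + b) := by
  classical
  obtain ⟨v₀, -⟩ := h
  have := Fintype.ofFinite V
  let D := inner G ℓ (i + 1)
  let R (k : ℕ) : List V := {u : V | ℓ u = i + 1 ∧ rest G D u = k}.toFinite.toFinset.toList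
  have hR {k u} : u ∈ R k ↔ ℓ u = i + 1 ∧ rest G D u = k := by
    simp only [R, Finset.mem_toList, Set.Finite.mem_toFinset]; rfl
  let l := R 2 ++ R 1
  have hnd : l.Nodup := by
    refine List.Nodup.append (Finset.nodup_toList _) (Finset.nodup_toList _) fun u h1 h2 => ?_
    have := (hR.mp h1).2
    have := (hR.mp h2).2
    omega
  have hl {u} : u ∈ l ↔ ℓ u = i + 1 ∧ (rest G D u = 2 ∨ rest G D u = 1) := by
    simp only [l, List.mem_append, hR]; tauto
  have hlen : l.length = (R 1).length + (R 2).length := by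
    simp only [l, List.length_append, Nat.add_comm]
  have hcard : l.length + {u | ℓ u ≤ i}.ncard ≤ {u | ℓ u ≤ i + 1}.ncard := by
    rw [← List.toFinset_card_of_nodup hnd, ← Set.ncard_coe_finset, ← Set.ncard_union_eq]
    · refine Set.ncard_le_ncard ?_ (Set.toFinite _)
      rintro u (hu | hu)
      · exact (hl.mp (by simpa using hu)).1.le
      · exact Nat.le_succ_of_le hu
    · rw [Set.disjoint_left]
      intro u hu hu'
      have := (hl.mp (by simpa using hu)).1
      have : ℓ u ≤ i := hu'
      omega
  let s (x : ℕ) : V := l.getD x v₀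
  have hs {x} (hx : x < l.length) : s x = l[x] := List.getD_eq_getElem _ _ hx
  have hsl {x} (hx : x < l.length) : s x ∈ l := hs hx ▸ List.getElem_mem hx
  refine ⟨(R 1).length, (R 2).length, by omega, D, s, ?_, ?_, by omega⟩
  · rw [← hlen]
    refine ⟨fun u v h => h.1, fun u v h h' => ?_, fun u v h => ?_, ?_, ?_, ?_, ?_, by omega⟩
    · by_contra hu
      exact h' ⟨h, .inl (by omega)⟩
    · exact h.2.imp Nat.le_of_lt Nat.le_of_lt
    · intro x hx y hy h
      rw [hs hx, hs hy] at h
      exact (hnd.getElem_inj_iff).mp h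
    · intro x hx
      have := (hl.mp (hsl hx)).1
      omega
    · rintro u hu (h | ⟨h, v, hv⟩)
      · have h3 : rest G D u < 3 := by
          rw [← L.reg u]
          refine Set.ncard_lt_ncard ⟨fun _ h => h.1, fun hsub => ?_⟩ (Set.toFinite _)
          obtain ⟨p, hp, hpi⟩ := L.parent u i h
          exact (hsub (show p ∈ G.neighborSet u from hp.symm)).2 ⟨hp.symm, .inr (by omega)⟩
        obtain ⟨x, hx, e⟩ := List.mem_iff_getElem.mp (hl.mpr ⟨h, by omega⟩)
        exact ⟨x, hx, by rw [hs hx, e]⟩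
      · have := L.adj v u hv.1.symm
        have := hv.2
        omega
    · intro b hb
      obtain ⟨x, hx, k, hk, e⟩ := startMatrix_bits hb
      exact ⟨x, hx, x, hx, k, hk, e, .refl _ _⟩
  · rw [startDigits_eq]
    refine enc_congr fun x hx => ?_
    rw [← hlen] at hx
    have h1 := (hl.mp (hsl hx)).1
    rw [slotDigit, h1, Nat.sub_self, Nat.mul_zero, Nat.add_zero, hs hx]
    by_cases hx2 : x < (R 2).length
    · have : l[x] = (R 2)[x] := List.getElem_append_left hx2
      rw [if_pos hx2, this, (hR.mp (List.getElem_mem hx2)).2]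
    · have : l[x] = (R 1)[x - (R 2).length] := List.getElem_append_right (by omega)
      rw [if_neg hx2, this, (hR.mp (List.getElem_mem _)).2]

/-- A boundary state without its weight. -/
def Shape (G : SimpleGraph V) (ℓ : V → ℕ) (i : ℕ) (S : State) : Prop :=
  ∃ H s, Frontier G ℓ H i s S.1 S.2.2.1 ∧ S.2.1 = enc (slotDigit G ℓ H i s) S.2.2.1

theorem window [Finite V] (L : Layering G ℓ) {i m : ℕ} {S : List State} {caps : List ℕ}
    (h : starts m .leaf (found S caps) = true) (hm : m ≤ 16)
    (hi : {u | ℓ u ≤ i + 1}.ncard ≤ {u | ℓ u ≤ i}.ncard + m)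
    (hu : ∃ u, ℓ u = i + 1 + caps.length + 2) (h2 : ∃ u, ℓ u = i + 3)
    (hc : Capped ℓ {u | ℓ u ≤ i}.ncard (i + 1) caps) :
    ∃ s ∈ S, Shape G ℓ (i + 1 + caps.length) s ∧
      s.2.2.2 + {u | ℓ u ≤ i}.ncard ≤ {u | ℓ u ≤ i + 1 + caps.length}.ncard := by
  obtain ⟨t, h, ht⟩ := starts_sound L (i := i + 1) (off := {u | ℓ u ≤ i}.ncard) h2 m .leaf _ h
  obtain ⟨s, hs, H, f, hF, hT, hw⟩ := found_sound L h hu hc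
    (ht (exists_boundary_start L hm hi (exists_level_pred L (exists_level_pred L h2))))
  exact ⟨s, hs, ⟨H, f, hF, hT⟩, hw⟩

theorem window_from [Finite V] (L : Layering G ℓ) {i off : ℕ} {S S' : List State} {caps : List ℕ}
    (h : found S caps (treeOf S') = true) (hu : ∃ u, ℓ u = i + caps.length + 2)
    (hc : Capped ℓ off i caps)
    (hS : ∃ s ∈ S', Shape G ℓ i s ∧ s.2.2.2 + off ≤ {u | ℓ u ≤ i}.ncard) :
    ∃ s ∈ S, Shape G ℓ (i + caps.length) s ∧
      s.2.2.2 + off ≤ {u | ℓ u ≤ i + caps.length}.ncard := by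
  obtain ⟨s, hs, ⟨H, f, hF, hT⟩, hw⟩ := hS
  obtain ⟨s, hs, H, f, hF, hT, hw⟩ := found_sound L h hu hc
    (Has.treeOf (Q := Boundary G ℓ i off) ⟨s, hs, H, f, hF, hT, hw⟩)
  exact ⟨s, hs, ⟨H, f, hF, hT⟩, hw⟩

end LayerSearch

namespace LayerSearch
open SimpleGraph STree

variable {V : Type*} {G H : SimpleGraph V} {ℓ : V → ℕ}

theorem exists_level_le (L : Layering G ℓ) {j k : ℕ} (hjk : j ≤ k) (h : ∃ u, ℓ u = k) :
    ∃ u, ℓ u = j := by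
  induction k, hjk using Nat.le_induction with
  | base => exact h
  | succ k _ ih => exact ih (exists_level_pred L h)

/-- The number of vertices up to layer `i`. -/
noncomputable def upTo (ℓ : V → ℕ) (i : ℕ) : ℕ := {u | ℓ u ≤ i}.ncard

local notation "C" => upTo ℓ
local notation "Sh" => Shape G ℓ

section
variable [Finite V] (L : Layering G ℓ) (h35 : ∃ u, ℓ u = 35)
include L h35

theorem min_one {i : ℕ} (hi : i + 1 ≤ 35) : C i + 1 ≤ C (i + 1) := by
  obtain ⟨u, hu⟩ := exists_level_le L hi h35
  refine Set.ncard_lt_ncard ⟨fun v hv => Nat.le_succ_of_le hv, fun h => ?_⟩ (Set.toFinite _)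
  have : ℓ u ≤ i := h (show ℓ u ≤ i + 1 from hu.le)
  omega

theorem window_long {i m : ℕ} {S : List State} {caps : List ℕ}
    (h : starts m .leaf (found S caps) = true) (hm : m ≤ 16)
    (hi : i + 1 + caps.length ≤ 33) (hi' : C (i + 1) ≤ C i + m) (hc : Capped ℓ (C i) (i + 1) caps) :
    ∃ s ∈ S, Sh (i + 1 + caps.length) s ∧ s.2.2.2 + C i ≤ C (i + 1 + caps.length) :=
  window L h hm hi' (exists_level_le L (by omega) h35) (exists_level_le L (by omega) h35) hc

theorem min_two {i : ℕ} (hi : i + 2 ≤ 33) : C i + 2 ≤ C (i + 2) := by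
  have := min_one L h35 (i := i) (by omega)
  have := min_one L h35 (i := i + 1) (by omega)
  change _ ≤ C (i + 2) at this
  omega

theorem min_three {i : ℕ} (hi : i + 3 ≤ 33) : C i + 4 ≤ C (i + 3) := by
  have m1 : _ ≤ C (i + 3) := min_one L h35 (i := i + 2) (by omega)
  have m2 : _ ≤ C (i + 3) := min_two L h35 (i := i + 1) (by omega)
  by_contra! h
  obtain ⟨s, hs, -⟩ := window_long L h35 run_min_three (by omega) hi (by omega)
    ⟨show C (i + 2) ≤ _ by omega, show C (i + 3) ≤ _ by omega, trivial⟩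
  cases hs

theorem min_four {i : ℕ} (hi : i + 4 ≤ 33) : C i + 6 ≤ C (i + 4) := by
  have m1 : _ ≤ C (i + 4) := min_one L h35 (i := i + 3) (by omega)
  have m2 : _ ≤ C (i + 4) := min_two L h35 (i := i + 2) (by omega)
  have m3 : _ ≤ C (i + 4) := min_three L h35 (i := i + 1) (by omega)
  by_contra! h
  obtain ⟨s, hs, -⟩ := window_long L h35 run_min_four (by omega) hi (by omega)
    ⟨show C (i + 2) ≤ _ by omega, show C (i + 3) ≤ _ by omega, show C (i + 4) ≤ _ by omega, trivial⟩
  cases hs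

theorem min_five {i : ℕ} (hi : i + 5 ≤ 33) : C i + 10 ≤ C (i + 5) := by
  have m1 : _ ≤ C (i + 5) := min_one L h35 (i := i + 4) (by omega)
  have m2 : _ ≤ C (i + 5) := min_two L h35 (i := i + 3) (by omega)
  have m3 : _ ≤ C (i + 5) := min_three L h35 (i := i + 2) (by omega)
  have m4 : _ ≤ C (i + 5) := min_four L h35 (i := i + 1) (by omega)
  by_contra! h
  obtain ⟨s, hs, -⟩ := window_long L h35 run_min_five (by omega) hi (by omega)
    ⟨show C (i + 2) ≤ _ by omega, show C (i + 3) ≤ _ by omega, show C (i + 4) ≤ _ by omega,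
      show C (i + 5) ≤ _ by omega, trivial⟩
  cases hs

theorem min_six {i : ℕ} (hi : i + 6 ≤ 33) : C i + 14 ≤ C (i + 6) := by
  have m1 : _ ≤ C (i + 6) := min_one L h35 (i := i + 5) (by omega)
  have m2 : _ ≤ C (i + 6) := min_two L h35 (i := i + 4) (by omega)
  have m3 : _ ≤ C (i + 6) := min_three L h35 (i := i + 3) (by omega)
  have m4 : _ ≤ C (i + 6) := min_four L h35 (i := i + 2) (by omega)
  have m5 : _ ≤ C (i + 6) := min_five L h35 (i := i + 1) (by omega)
  by_contra! h
  obtain ⟨s, hs, -⟩ := window_long L h35 run_min_six (by omega) hi (by omega)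
    ⟨show C (i + 2) ≤ _ by omega, show C (i + 3) ≤ _ by omega, show C (i + 4) ≤ _ by omega,
      show C (i + 5) ≤ _ by omega, show C (i + 6) ≤ _ by omega, trivial⟩
  cases hs

theorem shape_two {i : ℕ} (hi : i + 2 ≤ 33) (h : C (i + 2) ≤ C i + 2) : Sh (i + 2) (one 0) := by
  have m1 : _ ≤ C (i + 2) := min_one L h35 (i := i + 1) (by omega)
  obtain ⟨s, hs, hS, hw⟩ := window_long L h35 run_two (by omega) hi (by omega) ⟨h, trivial⟩
  obtain rfl := List.mem_singleton.mp hs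
  exact hS

theorem shape_three {i : ℕ} (hi : i + 3 ≤ 33) (h : C (i + 3) ≤ C i + 5) :
    4 + C i ≤ C (i + 3) ∧ (Sh (i + 3) (one 0) ∨ Sh (i + 3) (two 0)) := by
  have m1 : _ ≤ C (i + 3) := min_one L h35 (i := i + 2) (by omega)
  have m2 : _ ≤ C (i + 3) := min_two L h35 (i := i + 1) (by omega)
  obtain ⟨s, hs, hS, hw⟩ := window_long L h35 run_three (by omega) hi (by omega)
    ⟨show C (i + 2) ≤ _ by omega, show C (i + 3) ≤ _ by omega, trivial⟩
  simp only [List.mem_cons, List.not_mem_nil, or_false] at hs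
  obtain rfl | rfl := hs
  exacts [⟨hw, .inl hS⟩, ⟨hw, .inr hS⟩]

theorem shape_four {i : ℕ} (hi : i + 4 ≤ 33) (h : C (i + 4) ≤ C i + 8) :
    (8 + C i ≤ C (i + 4) ∧ Sh (i + 4) (one 0)) ∨ (6 + C i ≤ C (i + 4) ∧ Sh (i + 4) (two 0)) ∨
      (8 + C i ≤ C (i + 4) ∧ Sh (i + 4) (four 0)) := by
  have m1 : _ ≤ C (i + 4) := min_one L h35 (i := i + 3) (by omega)
  have m2 : _ ≤ C (i + 4) := min_two L h35 (i := i + 2) (by omega)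
  have m3 : _ ≤ C (i + 4) := min_three L h35 (i := i + 1) (by omega)
  obtain ⟨s, hs, hS, hw⟩ := window_long L h35 run_four (by omega) hi (by omega)
    ⟨show C (i + 2) ≤ _ by omega, show C (i + 3) ≤ _ by omega, show C (i + 4) ≤ _ by omega,
      trivial⟩
  simp only [List.mem_cons, List.not_mem_nil, or_false] at hs
  obtain rfl | rfl | rfl := hs
  exacts [.inl ⟨hw, hS⟩, .inr (.inl ⟨hw, hS⟩), .inr (.inr ⟨hw, hS⟩)]

theorem shape_five {i : ℕ} (hi : i + 5 ≤ 33) (h : C (i + 5) ≤ C i + 12) :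
    (12 + C i ≤ C (i + 5) ∧ Sh (i + 5) (one 0)) ∨ (10 + C i ≤ C (i + 5) ∧ Sh (i + 5) (two 0)) ∨
      (10 + C i ≤ C (i + 5) ∧ Sh (i + 5) (four 0)) := by
  have m1 : _ ≤ C (i + 5) := min_one L h35 (i := i + 4) (by omega)
  have m2 : _ ≤ C (i + 5) := min_two L h35 (i := i + 3) (by omega)
  have m4 : _ ≤ C (i + 5) := min_four L h35 (i := i + 1) (by omega)
  by_cases h2 : C (i + 2) ≤ C i + 7
  · obtain ⟨s, hs, hS, hw⟩ := window_long L h35 run_five (by omega) hi (by omega)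
      ⟨show C (i + 2) ≤ _ by omega, show C (i + 3) ≤ _ by omega, show C (i + 4) ≤ _ by omega,
        show C (i + 5) ≤ _ by omega, trivial⟩
    simp only [List.mem_cons, List.not_mem_nil, or_false] at hs
    obtain rfl | rfl | rfl := hs
    exacts [.inr (.inl ⟨hw, hS⟩), .inr (.inr ⟨hw, hS⟩), .inl ⟨hw, hS⟩]
  · have : _ ≤ C (i + 5) ∧ (Sh (i + 5) _ ∨ Sh (i + 5) _) := shape_three L h35 (i := i + 2) hi
      (show C (i + 5) ≤ _ by omega)
    obtain ⟨hw, hS | hS⟩ := this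
    exacts [.inl ⟨by omega, hS⟩, .inr (.inl ⟨by omega, hS⟩)]

theorem shape_six {i : ℕ} (hi : i + 6 ≤ 33) (h : C (i + 6) ≤ C i + 16) :
    (15 + C i ≤ C (i + 6) ∧ Sh (i + 6) (one 0)) ∨ (15 + C i ≤ C (i + 6) ∧ Sh (i + 6) (two 0)) ∨
      (14 + C i ≤ C (i + 6) ∧ Sh (i + 6) (four 0)) := by
  have m1 : _ ≤ C (i + 6) := min_one L h35 (i := i + 5) (by omega)
  have m2 : _ ≤ C (i + 6) := min_two L h35 (i := i + 4) (by omega)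
  have m5 : _ ≤ C (i + 6) := min_five L h35 (i := i + 1) (by omega)
  by_cases h2 : C (i + 2) ≤ C i + 8
  · by_cases h3 : C (i + 3) ≤ C i + 10
    · obtain ⟨s, hs, hS, hw⟩ := window_long L h35 run_six (by omega) hi (by omega)
        ⟨show C (i + 2) ≤ _ by omega, show C (i + 3) ≤ _ by omega, show C (i + 4) ≤ _ by omega,
          show C (i + 5) ≤ _ by omega, show C (i + 6) ≤ _ by omega, trivial⟩
      simp only [List.mem_cons, List.not_mem_nil, or_false] at hs
      obtain rfl | rfl | rfl := hs
      exacts [.inr (.inr ⟨hw, hS⟩), .inr (.inl ⟨hw, hS⟩), .inl ⟨hw, hS⟩]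
    · have : _ ≤ C (i + 6) ∧ (Sh (i + 6) _ ∨ Sh (i + 6) _) := shape_three L h35 (i := i + 3) hi
        (show C (i + 6) ≤ _ by omega)
      obtain ⟨hw, hS | hS⟩ := this
      exacts [.inl ⟨by omega, hS⟩, .inr (.inl ⟨by omega, hS⟩)]
  · have : (_ ≤ C (i + 6) ∧ Sh (i + 6) _) ∨ (_ ≤ C (i + 6) ∧ Sh (i + 6) _) ∨
        (_ ≤ C (i + 6) ∧ Sh (i + 6) _) := shape_four L h35 (i := i + 2) hi
      (show C (i + 6) ≤ _ by omega)
    obtain ⟨hw, hS⟩ | ⟨hw, hS⟩ | ⟨hw, hS⟩ := this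
    exacts [by omega, .inr (.inl ⟨by omega, hS⟩), by omega]

end

/-- The possible shapes of the frontier after a window of seven layers. -/
def Seven (G : SimpleGraph V) (ℓ : V → ℕ) (i off : ℕ) : Prop :=
  (23 + off ≤ upTo ℓ i ∧ Shape G ℓ i (five 0)) ∨ (22 + off ≤ upTo ℓ i ∧ Shape G ℓ i (eight 0)) ∨
    (21 + off ≤ upTo ℓ i ∧ Shape G ℓ i (four 0)) ∨ (21 + off ≤ upTo ℓ i ∧ Shape G ℓ i (two 0)) ∨
    (22 + off ≤ upTo ℓ i ∧ Shape G ℓ i (one 0))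

section
variable [Finite V] (L : Layering G ℓ) (h35 : ∃ u, ℓ u = 35)
include L h35

theorem shape_seven {i : ℕ} (hi : i + 7 ≤ 33) (h : C (i + 7) ≤ C i + 23) :
    Seven G ℓ (i + 7) (C i) := by
  have m1 : _ ≤ C (i + 7) := min_one L h35 (i := i + 6) (by omega)
  by_cases h1 : C (i + 1) ≤ C i + 6
  swap
  · have : (_ ≤ C (i + 7) ∧ Sh (i + 7) _) ∨ (_ ≤ C (i + 7) ∧ Sh (i + 7) _) ∨
        (_ ≤ C (i + 7) ∧ Sh (i + 7) _) := shape_six L h35 (i := i + 1) hi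
      (show C (i + 7) ≤ _ by omega)
    obtain ⟨hw, hS⟩ | ⟨hw, hS⟩ | ⟨hw, hS⟩ := this
    exacts [.inr (.inr (.inr (.inr ⟨by omega, hS⟩))), .inr (.inr (.inr (.inl ⟨by omega, hS⟩))),
      .inr (.inr (.inl ⟨by omega, hS⟩))]
  by_cases h2 : C (i + 2) ≤ C i + 10
  swap
  · have : (_ ≤ C (i + 7) ∧ Sh (i + 7) _) ∨ (_ ≤ C (i + 7) ∧ Sh (i + 7) _) ∨
        (_ ≤ C (i + 7) ∧ Sh (i + 7) _) := shape_five L h35 (i := i + 2) hi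
      (show C (i + 7) ≤ _ by omega)
    obtain ⟨hw, hS⟩ | ⟨hw, hS⟩ | ⟨hw, hS⟩ := this
    exacts [.inr (.inr (.inr (.inr ⟨by omega, hS⟩))), .inr (.inr (.inr (.inl ⟨by omega, hS⟩))),
      .inr (.inr (.inl ⟨by omega, hS⟩))]
  by_cases h3 : C (i + 3) ≤ C i + 14
  swap
  · have : (_ ≤ C (i + 7) ∧ Sh (i + 7) _) ∨ (_ ≤ C (i + 7) ∧ Sh (i + 7) _) ∨
        (_ ≤ C (i + 7) ∧ Sh (i + 7) _) := shape_four L h35 (i := i + 3) hi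
      (show C (i + 7) ≤ _ by omega)
    obtain ⟨hw, hS⟩ | ⟨hw, hS⟩ | ⟨hw, hS⟩ := this
    exacts [.inr (.inr (.inr (.inr ⟨by omega, hS⟩))), .inr (.inr (.inr (.inl ⟨by omega, hS⟩))),
      .inr (.inr (.inl ⟨by omega, hS⟩))]
  by_cases h4 : C (i + 4) ≤ C i + 17
  swap
  · have : _ ≤ C (i + 7) ∧ (Sh (i + 7) _ ∨ Sh (i + 7) _) := shape_three L h35 (i := i + 4) hi
      (show C (i + 7) ≤ _ by omega)
    obtain ⟨hw, hS | hS⟩ := this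
    exacts [.inr (.inr (.inr (.inr ⟨by omega, hS⟩))), .inr (.inr (.inr (.inl ⟨by omega, hS⟩)))]
  by_cases h5 : C (i + 5) ≤ C i + 20
  swap
  · have m2 : _ ≤ C (i + 7) := min_two L h35 (i := i + 5) (by omega)
    have : Sh (i + 7) _ := shape_two L h35 (i := i + 5) hi (show C (i + 7) ≤ _ by omega)
    exact .inr (.inr (.inr (.inr ⟨by omega, this⟩)))
  obtain ⟨s, hs, hS, hw⟩ := window_long L h35 run_seven (by omega) hi (by omega)
    ⟨show C (i + 2) ≤ _ by omega, show C (i + 3) ≤ _ by omega, show C (i + 4) ≤ _ by omega,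
      show C (i + 5) ≤ _ by omega, show C (i + 6) ≤ _ by omega, show C (i + 7) ≤ _ by omega,
        trivial⟩
  simp only [List.mem_cons, List.not_mem_nil, or_false] at hs
  obtain rfl | rfl := hs
  exacts [.inl ⟨hw, hS⟩, .inr (.inl ⟨hw, hS⟩)]

theorem Seven.next {i off : ℕ} (hs : Seven G ℓ i off) (hi : i + 7 ≤ 33)
    (h : C (i + 7) ≤ off + 46) :
    (46 + off ≤ C (i + 7) ∧ Sh (i + 7) (eight 0)) ∨ (44 + off ≤ C (i + 7) ∧ Sh (i + 7) (four 0)) ∨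
    (44 + off ≤ C (i + 7) ∧ Sh (i + 7) (two 0)) ∨ (45 + off ≤ C (i + 7) ∧ Sh (i + 7) (one 0)) := by
  have m1 : _ ≤ C (i + 7) := min_one L h35 (i := i + 6) (by omega)
  have m2 : _ ≤ C (i + 7) := min_two L h35 (i := i + 5) (by omega)
  by_cases h1 : C (i + 1) ≤ off + 29
  swap
  · have : (_ ≤ C (i + 7) ∧ Sh (i + 7) _) ∨ (_ ≤ C (i + 7) ∧ Sh (i + 7) _) ∨
        (_ ≤ C (i + 7) ∧ Sh (i + 7) _) := shape_six L h35 (i := i + 1) hi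
      (show C (i + 7) ≤ _ by omega)
    obtain ⟨hw, hS⟩ | ⟨hw, hS⟩ | ⟨hw, hS⟩ := this
    exacts [.inr (.inr (.inr ⟨by omega, hS⟩)), .inr (.inr (.inl ⟨by omega, hS⟩)),
      .inr (.inl ⟨by omega, hS⟩)]
  by_cases h2 : C (i + 2) ≤ off + 33
  swap
  · have : (_ ≤ C (i + 7) ∧ Sh (i + 7) _) ∨ (_ ≤ C (i + 7) ∧ Sh (i + 7) _) ∨
        (_ ≤ C (i + 7) ∧ Sh (i + 7) _) := shape_five L h35 (i := i + 2) hi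
      (show C (i + 7) ≤ _ by omega)
    obtain ⟨hw, hS⟩ | ⟨hw, hS⟩ | ⟨hw, hS⟩ := this
    exacts [.inr (.inr (.inr ⟨by omega, hS⟩)), .inr (.inr (.inl ⟨by omega, hS⟩)),
      .inr (.inl ⟨by omega, hS⟩)]
  by_cases h3 : C (i + 3) ≤ off + 37
  swap
  · have : (_ ≤ C (i + 7) ∧ Sh (i + 7) _) ∨ (_ ≤ C (i + 7) ∧ Sh (i + 7) _) ∨
        (_ ≤ C (i + 7) ∧ Sh (i + 7) _) := shape_four L h35 (i := i + 3) hi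
      (show C (i + 7) ≤ _ by omega)
    obtain ⟨hw, hS⟩ | ⟨hw, hS⟩ | ⟨hw, hS⟩ := this
    exacts [.inr (.inr (.inr ⟨by omega, hS⟩)), .inr (.inr (.inl ⟨by omega, hS⟩)),
      .inr (.inl ⟨by omega, hS⟩)]
  by_cases h4 : C (i + 4) ≤ off + 40
  swap
  · have : _ ≤ C (i + 7) ∧ (Sh (i + 7) _ ∨ Sh (i + 7) _) := shape_three L h35 (i := i + 4) hi
      (show C (i + 7) ≤ _ by omega)
    obtain ⟨hw, hS | hS⟩ := this
    exacts [.inr (.inr (.inr ⟨by omega, hS⟩)), .inr (.inr (.inl ⟨by omega, hS⟩))]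
  obtain ⟨s, hs, hS, hw⟩ := window_from L run_seven_more (exists_level_le L (by
      simp only [List.length_cons, List.length_nil]; omega) h35)
    ⟨h1, h2, h3, h4, show C (i + 5) ≤ _ by omega, show C (i + 6) ≤ _ by omega, h, trivial⟩ (by
      obtain ⟨hw, hS⟩ | ⟨hw, hS⟩ | ⟨hw, hS⟩ | ⟨hw, hS⟩ | ⟨hw, hS⟩ := hs
      · exact ⟨five 23, by simp, hS, hw⟩
      · exact ⟨eight 22, by simp, hS, hw⟩
      · exact ⟨four 21, by simp, hS, hw⟩
      · exact ⟨two 21, by simp, hS, hw⟩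
      · exact ⟨one 22, by simp, hS, hw⟩)
  obtain rfl := List.mem_singleton.mp hs
  exact .inl ⟨hw, hS⟩

theorem shape_tight {i off : ℕ} (hs : (21 + off ≤ C i ∧ Sh i (four 0)) ∨
    (21 + off ≤ C i ∧ Sh i (two 0)) ∨ (22 + off ≤ C i ∧ Sh i (one 0))) (hi : i + 7 ≤ 33)
    (h : C (i + 7) ≤ off + 45) :
    45 + off ≤ C (i + 7) ∧ (Sh (i + 7) (two 0) ∨ Sh (i + 7) (four 0)) := by
  have m1 : _ ≤ C (i + 7) := min_one L h35 (i := i + 6) (by omega)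
  have m2 : _ ≤ C (i + 7) := min_two L h35 (i := i + 5) (by omega)
  have m3 : _ ≤ C (i + 7) := min_three L h35 (i := i + 4) (by omega)
  have m4 : _ ≤ C (i + 7) := min_four L h35 (i := i + 3) (by omega)
  have m5 : _ ≤ C (i + 7) := min_five L h35 (i := i + 2) (by omega)
  have m6 : _ ≤ C (i + 7) := min_six L h35 (i := i + 1) (by omega)
  obtain ⟨s, hs, hS, hw⟩ := window_from L run_seven_tight (exists_level_le L (by
      simp only [List.length_cons, List.length_nil]; omega) h35)
    ⟨show C (i + 1) ≤ _ by omega, show C (i + 2) ≤ _ by omega, show C (i + 3) ≤ _ by omega,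
      show C (i + 4) ≤ _ by omega, show C (i + 5) ≤ _ by omega, show C (i + 6) ≤ _ by omega,
      h, trivial⟩ (by
      obtain ⟨hw, hS⟩ | ⟨hw, hS⟩ | ⟨hw, hS⟩ := hs
      · exact ⟨four 21, by simp, hS, hw⟩
      · exact ⟨two 21, by simp, hS, hw⟩
      · exact ⟨one 22, by simp, hS, hw⟩)
  simp only [List.mem_cons, List.not_mem_nil, or_false] at hs
  obtain rfl | rfl := hs
  exacts [⟨hw, .inl hS⟩, ⟨hw, .inr hS⟩]

theorem shape_twenty_one (h7 : ∀ i, i + 7 ≤ 35 → C i + 22 ≤ C (i + 7)) {i : ℕ}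
    (hi : i + 21 ≤ 33) (h : C (i + 7) ≤ C i + 23) (h' : C (i + 21) ≤ C i + 68) :
    C i + 68 ≤ C (i + 21) ∧ (Sh (i + 21) (two 0) ∨ Sh (i + 21) (four 0)) := by
  have hm : _ ≤ C (i + 21) := h7 (i + 14) (by omega)
  obtain ⟨hw, hS⟩ | hS : _ ∨ _ := (shape_seven L h35 (by omega) h).next L h35 (by omega)
    (show C (i + 14) ≤ _ by omega)
  · have hs : Seven G ℓ (i + 14) (C i + 24) :=
      .inr (.inl ⟨by change _ ≤ C (i + 14) at hw; omega, hS⟩)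
    obtain ⟨hw, hS⟩ | ⟨hw, hS⟩ | ⟨hw, hS⟩ | ⟨hw, hS⟩ := hs.next L h35 hi
      (show C (i + 21) ≤ _ by omega) <;> change _ ≤ C (i + 21) at hw
    · omega
    · exact ⟨by omega, .inr hS⟩
    · exact ⟨by omega, .inl hS⟩
    · omega
  · obtain ⟨hw, hS⟩ := shape_tight L h35 (i := i + 14) (off := C i + 23) (by
      obtain ⟨hw, hS⟩ | ⟨hw, hS⟩ | ⟨hw, hS⟩ := hS <;> change _ ≤ C (i + 14) at hw
      · exact .inl ⟨by omega, hS⟩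
      · exact .inr (.inl ⟨by omega, hS⟩)
      · exact .inr (.inr ⟨by omega, hS⟩)) hi (show C (i + 21) ≤ _ by omega)
    change _ ≤ C (i + 21) at hw
    exact ⟨by omega, hS⟩

theorem ninety_one_le (h7 : ∀ i, i + 7 ≤ 35 → C i + 22 ≤ C (i + 7)) : C 3 + 91 ≤ C 31 := by
  have w3 : _ ≤ C 24 := h7 17 (by norm_num)
  have w4 : _ ≤ C 31 := h7 24 (by norm_num)
  by_cases h1 : C 10 ≤ C 3 + 23
  · by_contra! h
    obtain ⟨hw, hS⟩ := shape_twenty_one L h35 h7 (i := 3) (by norm_num) h1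
      (show C 24 ≤ _ by omega)
    change _ ≤ C 24 at hw
    have := (shape_tight L h35 (i := 24) (off := C 3 + 47) (by
      obtain hS | hS := hS
      · exact .inr (.inl ⟨by omega, hS⟩)
      · exact .inl ⟨by omega, hS⟩) (by norm_num) (show C 31 ≤ _ by omega)).1
    change _ ≤ C 31 at this
    omega
  · by_cases h2 : C 17 ≤ C 10 + 23
    · by_contra! h
      have := (shape_twenty_one L h35 h7 (i := 10) (by norm_num) h2 (show C 31 ≤ _ by omega)).1
      change _ ≤ C 31 at this
      omega
    · omega

end
end LayerSearch

namespace LayerSearch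
open SimpleGraph STree

variable {V : Type*} {G H : SimpleGraph V} {ℓ : V → ℕ}

theorem layering_dist (hG : G.Connected) (hr : ∀ v, (G.neighborSet v).ncard = 3)
    (hg : ∀ u (p : G.Walk u u), p.IsCycle → 7 ≤ p.length) (v : V) : Layering G (G.dist v) where
  adj x y h := by
    have := hG.dist_triangle (u := v) (v := x) (w := y)
    rwa [dist_eq_one_iff_adj.mpr h] at this
  parent w j h := by
    obtain ⟨p, hp⟩ := hG.exists_walk_length_eq_dist w v
    rw [dist_comm, h] at hp
    cases p with
    | nil => simp at hp
    | @cons _ u _ hu q =>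
      refine ⟨u, hu.symm, ?_⟩
      have h1 := dist_le q.reverse
      have h2 := hG.dist_triangle (u := v) (v := u) (w := w)
      rw [dist_eq_one_iff_adj.mpr hu.symm] at h2
      simp only [Walk.length_cons, Walk.length_reverse] at *
      omega
  reg := hr
  girth := hg

theorem ball_card [Finite V] (hG : G.Connected) {v : V} (L : Layering G (G.dist v))
    (h5 : ∃ u, G.dist v u = 5) : 22 ≤ {u | G.dist v u ≤ 3}.ncard := by
  by_contra! h
  have hle {i : ℕ} (hi : i ≤ 3) : {u | G.dist v u ≤ i}.ncard ≤ 0 + 21 := by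
    have := Set.ncard_le_ncard (s := {u | G.dist v u ≤ i}) (t := {u | G.dist v u ≤ 3})
      (fun u hu => le_trans hu hi) (Set.toFinite _)
    omega
  have found := found_sound L (i := 0) (off := 0) run_ball h5
    ⟨hle (by norm_num), hle (by norm_num), hle (by norm_num), trivial⟩
  refine absurd (found (.inr (.inl ?_))) ?_
  · have hr : rest G ⊥ v = 3 := rest_of_forall L fun _ => id
    have h0 : {u | G.dist v u ≤ 0} = {v} := by
      ext u
      simp [hG.dist_eq_zero_iff, eq_comm]
    refine ⟨⊥, fun _ => v, ⟨bot_le, fun _ _ _ _ => Nat.zero_le _, fun _ _ h => h.elim,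
      fun x hx y hy _ => by omega, fun x _ => by simp, ?_, ?_, by norm_num⟩, ?_, ?_⟩
    · rintro u - (h | ⟨-, _, h⟩)
      · exact ⟨0, one_pos, hG.dist_eq_zero_iff.mp h⟩
      · exact h.elim
    · intro b hb
      exact ⟨0, one_pos, 0, one_pos, b, testBit_lt hb (by decide), by omega, .refl _ _⟩
    · simp [enc, slotDigit, hr]
    · rw [h0, Set.ncard_singleton]
  · rintro ⟨s, hs, -⟩
    cases hs

theorem even_card [Fintype V] (hr : ∀ v, (G.neighborSet v).ncard = 3) :
    Even (Fintype.card V) := by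
  classical
  have h3 (v : V) : G.degree v = 3 := by
    rw [← hr v, ← card_neighborSet_eq_degree, Set.ncard_eq_toFinset_card', Set.toFinset_card]
  have := G.sum_degrees_eq_twice_card_edges
  simp only [h3, Finset.sum_const, Finset.card_univ, smul_eq_mul] at this
  rw [Nat.even_iff]
  omega

theorem card_ge [Fintype V] (h : IsKGDGraph 3 7 35 G) : 136 ≤ Fintype.card V := by
  obtain ⟨hr, hg, hd⟩ := h
  have hcyc : ∀ u (p : G.Walk u u), p.IsCycle → 7 ≤ p.length := by
    intro u p hp
    have := le_egirth.mp hg.ge u p hp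
    exact_mod_cast this
  have : Nonempty V := by
    by_contra hV
    rw [not_nonempty_iff] at hV
    simp [ediam_eq_zero_of_subsingleton] at hd
  have hG : G.Connected := by
    refine ⟨fun u v => edist_ne_top_iff_reachable.mp fun h => ?_⟩
    have := edist_le_ediam (G := G) (u := u) (v := v)
    rw [h, hd] at this
    simp at this
  obtain ⟨v, w, hvw⟩ := G.exists_edist_eq_ediam_of_finite
  replace hvw : G.dist v w = 35 := by rw [SimpleGraph.dist, hvw, hd]; rfl
  have L := layering_dist hG hr hcyc
  have ball (u : V) : 22 ≤ {x | G.dist u x ≤ 3}.ncard := by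
    refine ball_card hG (L u) ?_
    have := hG.dist_triangle (u := v) (v := u) (w := w)
    rw [hvw] at this
    have := G.dist_comm (u := v) (v := u)
    by_cases h : 5 ≤ G.dist u v
    · exact exists_level_le (L u) h ⟨v, rfl⟩
    · exact exists_level_le (L u) (show 5 ≤ G.dist u w by omega) ⟨w, rfl⟩
  have h35 : ∃ u, G.dist v u = 35 := ⟨w, hvw⟩
  have gap {i j : ℕ} {u : V} (h1 : i + 4 ≤ G.dist v u) (h2 : G.dist v u + 3 ≤ j) :
      upTo (G.dist v) i + 22 ≤ upTo (G.dist v) j := by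
    refine (Nat.add_le_add_left (ball u) _).trans ?_
    rw [upTo, upTo, ← Set.ncard_union_eq]
    · refine Set.ncard_le_ncard ?_ (Set.toFinite _)
      rintro x (hx | hx) <;> simp only [Set.mem_ofPred_eq] at hx ⊢
      · omega
      · have := hG.dist_triangle (u := v) (v := u) (w := x)
        omega
    · rw [Set.disjoint_left]
      intro x hx hx'
      simp only [Set.mem_ofPred_eq] at hx hx'
      have := hG.dist_triangle (u := v) (v := x) (w := u)
      rw [dist_comm (u := x)] at this
      omega
  have mid := ninety_one_le (L v) h35 fun i hi => by
    obtain ⟨u, hu⟩ := exists_level_le (L v) (show i + 4 ≤ 35 by omega) h35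
    exact gap hu.ge (by omega)
  have last := gap (i := 31) (j := 38) hvw.ge (by omega)
  have first : 22 ≤ upTo (G.dist v) 3 := ball v
  have total : upTo (G.dist v) 38 ≤ Fintype.card V := by
    rw [← Nat.card_eq_fintype_card]
    exact Set.ncard_le_card _
  have := even_card hr
  rw [Nat.even_iff] at this
  omega

end LayerSearch

namespace Cage
open SimpleGraph

/-- The neighbours of the vertices `0, …, 135`, listed in the order of their distance from `0`. The
graph is a chain of five pieces joined by bridges: a piece on 29 vertices, two copies of the McGee
graph minus an edge, the Tutte–Coxeter graph minus an edge, and the first piece reversed. -/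
def neighbours : List (List ℕ) :=
  [[1, 2, 3], [0, 4, 5], [0, 6, 7], [0, 8, 9], [1, 10, 11], [1, 12, 13], [2, 14, 15], [2, 16, 17],
   [3, 18, 19], [3, 20, 21], [4, 15, 22], [4, 16, 23], [5, 14, 20], [5, 17, 19], [6, 12, 18],
   [6, 10, 24], [7, 11, 25], [7, 13, 21], [8, 14, 25], [8, 13, 24], [9, 12, 23], [9, 17, 22],
   [10, 21, 26], [11, 20, 27], [15, 19, 27], [16, 18, 26], [22, 25, 28], [23, 24, 28],
   [26, 27, 29], [28, 30, 31], [29, 32, 33], [29, 34, 35], [30, 36, 37], [30, 38, 39],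
   [31, 40, 41], [31, 42, 43], [32, 42, 44], [32, 41, 45], [33, 40, 46], [33, 43, 47],
   [34, 38, 44], [34, 37, 48], [35, 36, 49], [35, 39, 45], [36, 40, 50], [37, 43, 51],
   [38, 49, 51], [39, 48, 50], [41, 47, 49], [42, 46, 48], [44, 47, 52], [45, 46, 52],
   [50, 51, 53], [52, 54, 55], [53, 56, 57], [53, 58, 59], [54, 60, 61], [54, 62, 63],
   [55, 64, 65], [55, 66, 67], [56, 66, 68], [56, 65, 69], [57, 64, 70], [57, 67, 71],
   [58, 62, 68], [58, 61, 72], [59, 60, 73], [59, 63, 69], [60, 64, 74], [61, 67, 75],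
   [62, 73, 75], [63, 72, 74], [65, 71, 73], [66, 70, 72], [68, 71, 76], [69, 70, 76],
   [74, 75, 77], [76, 78, 79], [77, 80, 81], [77, 82, 83], [78, 84, 85], [78, 86, 87],
   [79, 88, 89], [79, 90, 91], [80, 92, 93], [80, 94, 95], [81, 96, 97], [81, 98, 99],
   [82, 94, 98], [82, 93, 96], [83, 92, 97], [83, 95, 99], [84, 90, 100], [84, 89, 101],
   [85, 88, 102], [85, 91, 103], [86, 89, 103], [86, 90, 102], [87, 88, 100], [87, 91, 101],
   [92, 98, 104], [93, 99, 105], [94, 97, 105], [95, 96, 104], [100, 103, 106], [101, 102, 106],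
   [104, 105, 107], [106, 108, 109], [107, 110, 111], [107, 112, 113], [108, 114, 115],
   [108, 116, 117], [109, 118, 119], [109, 120, 121], [110, 118, 122], [110, 123, 124],
   [111, 120, 125], [111, 126, 127], [112, 114, 128], [112, 126, 129], [113, 116, 122],
   [113, 123, 130], [114, 120, 131], [115, 121, 132], [115, 125, 129], [116, 124, 133],
   [117, 119, 132], [117, 128, 130], [118, 127, 133], [119, 124, 134], [121, 127, 134],
   [122, 134, 135], [123, 126, 135], [125, 128, 135], [129, 130, 131], [131, 132, 133]]

/-- The first vertex at each positive distance from `0`. -/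
def starts : List ℕ :=
  [1, 4, 10, 22, 26, 28, 29, 30, 32, 36, 44, 50, 52, 53, 54, 56, 60, 68, 74, 76, 77, 78, 80, 84,
   92, 100, 104, 106, 107, 108, 110, 114, 122, 131, 135]

def level (v : ℕ) : ℕ := (starts.filter (Nat.ble · v)).length

def nbrs (v : ℕ) : List ℕ := neighbours.getD v []

theorem nbrs_symm : ∀ u < 136, ∀ v ∈ nbrs u, u ∈ nbrs v := by decide +kernel

theorem nbrs_irrefl : ∀ u < 136, u ∉ nbrs u := by decide +kernel

theorem nbrs_nodup : ∀ u < 136, (nbrs u).Nodup ∧ (nbrs u).length = 3 ∧ ∀ v ∈ nbrs u, v < 136 := by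
  decide +kernel

theorem nbrs_level : ∀ u < 136, ∀ v ∈ nbrs u, level v ≤ level u + 1 := by decide +kernel

def graph : SimpleGraph (Fin 136) where
  Adj u v := v.val ∈ nbrs u
  symm := ⟨fun u v h => nbrs_symm u u.2 v h⟩
  loopless := ⟨fun u => nbrs_irrefl u u.2⟩

theorem graph_regular : IsRegular' 3 graph := by
  intro u
  obtain ⟨hn, hl, hlt⟩ := nbrs_nodup u u.2
  have : Fin.val '' graph.neighborSet u = (nbrs u).toFinset := by
    ext v
    simp only [Set.mem_image, mem_neighborSet, List.coe_toFinset, Set.mem_ofPred_eq]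
    exact ⟨fun ⟨w, hw, h⟩ => h ▸ hw, fun h => ⟨⟨v, hlt v h⟩, h, rfl⟩⟩
  rw [← Set.ncard_image_of_injective _ Fin.val_injective, this, Set.ncard_coe_finset,
    List.toFinset_card_of_nodup hn, hl]

/-- No walk of length `1, …, n` from `v` to `t` that never turns back starts with a step different
from the step back to `u`. -/
def avoids (t : ℕ) : ℕ → ℕ → ℕ → Bool
  | 0, _, _ => true
  | n + 1, u, v => (nbrs v).all fun w => w == u || (w != t && avoids t n v w)

theorem avoids_all : ∀ u < 136, ∀ v ∈ nbrs u, avoids u 5 u v = true := by decide +kernel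

theorem lt_length_of_avoids {t : Fin 136} {n : ℕ} : ∀ {u v : Fin 136} (p : graph.Walk v t),
    avoids t n u v = true → p.IsTrail → s(u, v) ∉ p.edges → ¬ p.Nil → n < p.length := by
  induction n with
  | zero => exact fun p _ _ _ hp => Nat.pos_of_ne_zero fun h => hp (Walk.length_eq_zero_iff.mp h)
  | succ n ih =>
    intro u v p h ht he hp
    cases p with
    | nil => simp at hp
    | @cons _ w _ hw q =>
      rw [Walk.isTrail_cons] at ht
      simp only [Walk.edges_cons, List.mem_cons, not_or] at he
      simp only [avoids, List.all_eq_true, Bool.or_eq_true, Bool.and_eq_true, beq_iff_eq,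
        bne_iff_ne] at h
      obtain h | ⟨hwt, h⟩ := h w hw
      · obtain rfl := Fin.ext h
        exact absurd Sym2.eq_swap he.1
      · have hq : ¬ q.Nil := fun hq => by simp [hq.eq] at hwt
        simpa using ih q h ht.1 ht.2 hq

instance (u v : Fin 136) : Decidable (graph.Adj u v) := inferInstanceAs (Decidable (v.val ∈ nbrs u))

theorem graph_egirth : graph.egirth = 7 := by
  apply le_antisymm
  · let p : graph.Walk 0 0 := .cons (v := 1) (by decide +kernel) <|
      .cons (v := 4) (by decide +kernel) <| .cons (v := 10) (by decide +kernel) <|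
      .cons (v := 15) (by decide +kernel) <| .cons (v := 6) (by decide +kernel) <|
      .cons (v := 2) (by decide +kernel) <| .cons (by decide +kernel) .nil
    have hp : p.IsCycle := by
      rw [Walk.cons_isCycle_iff, Walk.isPath_def]
      decide +kernel
    exact egirth_le_length hp
  · rw [le_egirth]
    intro u p hp
    cases p with
    | nil => exact absurd rfl hp.ne_nil
    | @cons _ v _ h q =>
      rw [Walk.cons_isCycle_iff] at hp
      have := lt_length_of_avoids q (avoids_all u u.2 v h) hp.1.isTrail hp.2
        fun hq => h.ne hq.eq.symm
      rw [Walk.length_cons]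
      exact_mod_cast (by omega : 7 ≤ q.length + 1)

/-- The union of the sets of bits of the numbers `f x` for `x ∈ l`. -/
def union (l : List ℕ) (f : ℕ → ℕ) : ℕ := l.foldr (fun x a => Nat.lor a (f x)) 0

theorem exists_of_testBit_union {l : List ℕ} {f : ℕ → ℕ} {k : ℕ} (h : (union l f).testBit k) :
    ∃ x ∈ l, (f x).testBit k := by
  induction l with
  | nil => simp [union] at h
  | cons x l ih =>
    have : (union l f ||| f x).testBit k := h
    rw [Nat.testBit_or, Bool.or_eq_true] at this
    obtain h | h := this
    · obtain ⟨y, hy, h⟩ := ih h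
      exact ⟨y, by simp [hy], h⟩
    · exact ⟨x, by simp, h⟩

/-- Bit `136 * u + v` of `reach n` tells whether `v` is at distance at most `n` from `u`. -/
def reach : ℕ → ℕ
  | 0 => union (List.range 136) fun u => 2 ^ (137 * u)
  | n + 1 => Nat.lor (reach n) (union (List.range 136) fun u =>
      union (nbrs u) fun w => (reach n >>> (136 * w) % 2 ^ 136) <<< (136 * u))

theorem edist_le_of_testBit_reach {n : ℕ} : ∀ {u v : Fin 136},
    (reach n).testBit (136 * u + v) → graph.edist u v ≤ n := by
  induction n with
  | zero =>
    intro u v h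
    obtain ⟨x, hx, h⟩ := exists_of_testBit_union h
    rw [Nat.testBit_two_pow] at h
    have h := of_decide_eq_true h
    have : u = v := Fin.ext (by rw [List.mem_range] at hx; omega)
    simp [this]
  | succ n ih =>
    intro u v h
    replace h : (reach n ||| _).testBit _ = true := h
    rw [Nat.testBit_or, Bool.or_eq_true] at h
    obtain h | h := h
    · exact (ih h).trans (by simp)
    · obtain ⟨x, hx, h⟩ := exists_of_testBit_union h
      obtain ⟨w, hw, h⟩ := exists_of_testBit_union h
      simp only [Nat.testBit_shiftLeft, Nat.testBit_mod_two_pow, Nat.testBit_shiftRight,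
        Bool.and_eq_true, decide_eq_true_eq] at h
      obtain ⟨h1, h2, h3⟩ := h
      obtain rfl : x = u := by omega
      have hw' := (nbrs_nodup u u.2).2.2 w hw
      have huw : graph.Adj u ⟨w, hw'⟩ := hw
      rw [show 136 * w + (136 * u.val + v - 136 * u) = 136 * w + v by omega] at h3
      have := ih (u := ⟨w, hw'⟩) h3
      calc graph.edist u v ≤ graph.edist u ⟨w, hw'⟩ + graph.edist ⟨w, hw'⟩ v :=
            SimpleGraph.edist_triangle
        _ ≤ 1 + n := add_le_add (edist_eq_one_iff_adj.mpr huw).le this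
        _ = _ := by rw [add_comm]; rfl

theorem reach_full : reach 35 = 2 ^ (136 * 136) - 1 := by decide +kernel

theorem level_le_length {u v : Fin 136} (p : graph.Walk u v) : level v ≤ level u + p.length := by
  induction p with
  | nil => simp
  | @cons u w _ h p ih =>
    have := nbrs_level u u.2 w h
    rw [Walk.length_cons]
    omega

theorem graph_ediam : graph.ediam = 35 := by
  apply le_antisymm
  · refine ediam_le_of_edist_le fun u v => edist_le_of_testBit_reach (n := 35) ?_
    rw [reach_full, Nat.testBit_two_pow_sub_one, decide_eq_true_eq]
    omega
  · refine le_trans ?_ (edist_le_ediam (u := 0) (v := 135))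
    refine le_iInf fun p => ?_
    have : level 135 ≤ level 0 + p.length := level_le_length p
    have h : level 135 = level 0 + 35 := by decide +kernel
    exact_mod_cast (by omega : 35 ≤ p.length)

theorem graph_isKGDGraph : IsKGDGraph 3 7 35 graph := ⟨graph_regular, graph_egirth, graph_ediam⟩

end Cage

theorem minOrder_three_seven_thirtyfive :
    (∃ G : SimpleGraph (Fin 136), IsKGDGraph 3 7 35 G) ∧
    ∀ {V : Type} [Fintype V] (G : SimpleGraph V), IsKGDGraph 3 7 35 G →
      136 ≤ Fintype.card V :=
  ⟨⟨Cage.graph, Cage.graph_isKGDGraph⟩, fun _ h => LayerSearch.card_ge h⟩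
end

section
/- n(4;4,5) = 18, and there exists a (4;4,5)-cage that is 2-connected and non-bipartite; that is, there is a 2-connected, non-bipartite, 4-regular simple graph with girth exactly 4, diameter exactly 5, and 18 vertices, while every 4-regular simple graph with girth exactly 4 and diameter exactly 5 has at least 18 vertices. -/
namespace SimpleGraph

theorem ncard_neighborSet {V : Type*} (G : SimpleGraph V) (x : V) [Fintype (G.neighborSet x)] :
    (G.neighborSet x).ncard = G.degree x := by
  rw [← Nat.card_coe_set_eq, Nat.card_eq_fintype_card, card_neighborSet_eq_degree]

/-- A graph whose extended girth is at least `4` has no triangle. -/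
theorem not_adj_of_four_le_egirth {V : Type*} {G : SimpleGraph V} (hG : 4 ≤ G.egirth)
    {a b c : V} (hab : G.Adj a b) (hbc : G.Adj b c) : ¬ G.Adj a c := by
  classical
  intro hac
  obtain ⟨x, w, hw, hlen⟩ := (is3Clique_iff_exists_cycle_length_three (G := G)).1
    ⟨{a, b, c}, is3Clique_triple_iff.2 ⟨hab, hac, hbc⟩⟩
  have h := hG.trans (egirth_le_length hw)
  rw [hlen] at h
  exact absurd h (by decide)

/-- A graph without triangles has extended girth at least `4`. -/
theorem four_le_egirth_of_triangle_free {V : Type*} {G : SimpleGraph V}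
    (h : ∀ a b c, G.Adj a b → G.Adj b c → ¬ G.Adj a c) : 4 ≤ G.egirth := by
  classical
  refine le_egirth.2 fun a w hw => ?_
  have h3 := hw.three_le_length
  have hne : w.length ≠ 3 := by
    intro hlen
    obtain ⟨s, hs⟩ := (is3Clique_iff_exists_cycle_length_three (G := G)).2 ⟨a, w, hw, hlen⟩
    obtain ⟨x, y, z, hxy, hxz, hyz, -⟩ := is3Clique_iff.1 hs
    exact h x y z hxy hyz hxz
  exact_mod_cast (by omega : 4 ≤ w.length)

/-- A set of vertices closed under adjacency contains every vertex reachable from it. -/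
theorem Reachable.mem_of_forall_adj {V : Type*} {G : SimpleGraph V} {u v : V}
    (huv : G.Reachable u v) {S : Set V} (hu : u ∈ S)
    (hS : ∀ x ∈ S, ∀ y, G.Adj x y → y ∈ S) : v ∈ S := by
  obtain ⟨p⟩ := huv
  induction p with
  | nil => exact hu
  | cons hadj _ ih => exact ih (hS _ hu _ hadj)

/-- In a `k`-regular graph without triangles, a closed ball of radius `2` that misses a vertex of
the component of its centre has at least `2 * k + 1` vertices. -/
theorem two_mul_add_one_le_card_ball {V : Type*} [Fintype V] {G : SimpleGraph V}
    [DecidableEq V] [DecidableRel G.Adj] {k : ℕ} (hreg : ∀ x, G.degree x = k)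
    (hG : 4 ≤ G.egirth) {u v : V} (huv : G.Reachable u v) (hfar : 2 < G.edist u v) :
    2 * k + 1 ≤ {x | G.edist u x ≤ 2}.ncard := by
  set D₁ := G.neighborFinset u with hD₁
  set D₂ := Finset.univ.filter fun x => x ≠ u ∧ ∃ y ∈ D₁, G.Adj y x with hD₂
  have mem₁ : ∀ x, x ∈ D₁ ↔ G.Adj u x := fun x => by simp [hD₁]
  have mem₂ : ∀ x, x ∈ D₂ ↔ x ≠ u ∧ ∃ y, G.Adj u y ∧ G.Adj y x := fun x => by simp [hD₂, mem₁]
  have ball₁ : ∀ x ∈ D₁, G.edist u x ≤ 2 := fun x hx =>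
    (edist_eq_one_iff_adj.2 ((mem₁ x).1 hx)).le.trans (by decide)
  have ball₂ : ∀ x ∈ D₂, G.edist u x ≤ 2 := fun x hx => by
    obtain ⟨-, y, huy, hyx⟩ := (mem₂ x).1 hx
    exact edist_le (.cons huy (.cons hyx .nil))
  obtain ⟨z, hz, w, hzw, hw⟩ : ∃ z ∈ D₂, ∃ w, G.Adj z w ∧ w ∉ D₁ := by
    by_contra! hcon
    have hv : v ∈ {x | x = u ∨ x ∈ D₁ ∨ x ∈ D₂} := by
      refine huv.mem_of_forall_adj (Or.inl rfl) ?_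
      rintro x (rfl | hx | hx) y hxy
      · exact Or.inr (Or.inl ((mem₁ y).2 hxy))
      · by_cases hyu : y = u
        · exact Or.inl hyu
        · exact Or.inr (Or.inr ((mem₂ y).2 ⟨hyu, x, (mem₁ x).1 hx, hxy⟩))
      · exact Or.inr (Or.inl (hcon x hx y hxy))
    refine hfar.not_ge ?_
    rcases hv with rfl | hv | hv
    · simp
    · exact ball₁ v hv
    · exact ball₂ v hv
  have hleft : ∀ y ∈ D₁, (D₂.bipartiteAbove G.Adj y).card = k - 1 := by
    intro y hy
    have huy := (mem₁ y).1 hy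
    have : D₂.bipartiteAbove G.Adj y = (G.neighborFinset y).erase u := by
      ext x
      simp only [Finset.mem_bipartiteAbove, mem₂, Finset.mem_erase, mem_neighborFinset]
      exact ⟨fun h => ⟨h.1.1, h.2⟩, fun h => ⟨⟨h.1, y, huy, h.2⟩, h.2⟩⟩
    rw [this, Finset.card_erase_of_mem (by simpa using huy.symm), card_neighborFinset_eq_degree,
      hreg]
  have hsub : ∀ x, D₁.bipartiteBelow G.Adj x ⊆ G.neighborFinset x := fun x y hy => by
    simpa using ((Finset.mem_bipartiteBelow _).1 hy).2.symm
  have hright : ∀ x ∈ D₂, (D₁.bipartiteBelow G.Adj x).card ≤ k := fun x _ => by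
    rw [← hreg x, ← card_neighborFinset_eq_degree]
    exact Finset.card_le_card (hsub x)
  have hstrict : (D₁.bipartiteBelow G.Adj z).card < k := by
    rw [← hreg z, ← card_neighborFinset_eq_degree]
    exact Finset.card_lt_card ((Finset.ssubset_iff_of_subset (hsub z)).2
      ⟨w, by simpa using hzw, fun h => hw ((Finset.mem_bipartiteBelow _).1 h).1⟩)
  have hcard₁ : D₁.card = k := by rw [hD₁, card_neighborFinset_eq_degree, hreg]
  have hcount := Finset.sum_card_bipartiteAbove_eq_sum_card_bipartiteBelow (s := D₁) (t := D₂)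
    G.Adj
  have hlt := Finset.sum_lt_sum hright ⟨z, hz, hstrict⟩
  rw [← hcount, Finset.sum_congr rfl hleft, Finset.sum_const, Finset.sum_const, hcard₁,
    smul_eq_mul, smul_eq_mul, mul_comm D₂.card] at hlt
  have hcard₂ : k ≤ D₂.card := by
    have := Nat.lt_of_mul_lt_mul_left hlt
    omega
  have hdisj : Disjoint D₁ D₂ := Finset.disjoint_left.2 fun x hx₁ hx₂ => by
    obtain ⟨-, y, huy, hyx⟩ := (mem₂ x).1 hx₂
    exact not_adj_of_four_le_egirth hG huy hyx ((mem₁ x).1 hx₁)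
  have hu : u ∉ D₁ ∪ D₂ := by simp [mem₁, mem₂]
  calc 2 * k + 1 ≤ (insert u (D₁ ∪ D₂)).card := by
        rw [Finset.card_insert_of_notMem hu, Finset.card_union_of_disjoint hdisj]
        omega
    _ = (↑(insert u (D₁ ∪ D₂)) : Set V).ncard := (Set.ncard_coe_finset _).symm
    _ ≤ _ := by
        refine Set.ncard_le_ncard (fun x hx => ?_) (Set.toFinite _)
        simp only [Finset.coe_insert, Finset.coe_union, Set.mem_insert_iff, Set.mem_union,
          Finset.mem_coe] at hx
        rcases hx with rfl | hx | hx
        · simp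
        · exact ball₁ x hx
        · exact ball₂ x hx

/-- A finite `k`-regular graph without triangles and of diameter `5` has at least `4 * k + 2`
vertices. -/
theorem four_mul_add_two_le_card_of_ediam_eq_five {V : Type*} [Fintype V] {G : SimpleGraph V}
    [DecidableEq V] [DecidableRel G.Adj] {k : ℕ} (hreg : ∀ x, G.degree x = k)
    (hG : 4 ≤ G.egirth) (hdiam : G.ediam = 5) : 4 * k + 2 ≤ Fintype.card V := by
  have : Nontrivial V := nontrivial_of_ediam_ne_zero (by rw [hdiam]; decide)
  obtain ⟨u, v, huv⟩ := G.exists_edist_eq_ediam_of_finite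
  rw [hdiam] at huv
  have hr : G.Reachable u v := reachable_of_edist_ne_top (by rw [huv]; decide)
  have hu := two_mul_add_one_le_card_ball hreg hG hr (by rw [huv]; decide)
  have hv := two_mul_add_one_le_card_ball hreg hG hr.symm (by rw [edist_comm, huv]; decide)
  have hdisj : Disjoint {x | G.edist u x ≤ 2} {x | G.edist v x ≤ 2} := by
    refine Set.disjoint_left.2 fun x (hx : G.edist u x ≤ 2) (hx' : G.edist v x ≤ 2) => ?_
    have h : G.edist u v ≤ 2 + 2 :=
      G.edist_triangle.trans (add_le_add hx (G.edist_comm.trans_le hx'))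
    rw [huv] at h
    exact absurd h (by decide)
  have hle := Set.ncard_le_card ({x | G.edist u x ≤ 2} ∪ {x | G.edist v x ≤ 2})
  rw [Set.ncard_union_eq hdisj (Set.toFinite _) (Set.toFinite _), Nat.card_eq_fintype_card] at hle
  omega

/-- A graph with a root `a` and a rank function such that every vertex other than `a` has a
neighbour of smaller rank is connected. -/
theorem connected_of_rank {V : Type*} {G : SimpleGraph V} (a : V) (r : V → ℕ)
    (h : ∀ x, x ≠ a → ∃ y, G.Adj x y ∧ r y < r x) : G.Connected := by
  have key : ∀ n x, r x = n → G.Reachable x a := by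
    intro n
    induction n using Nat.strong_induction_on with
    | _ n ih =>
      intro x hx
      by_cases hxa : x = a
      · rw [hxa]
      · obtain ⟨y, hxy, hy⟩ := h x hxa
        exact hxy.reachable.trans (ih (r y) (hx ▸ hy) y rfl)
  have : Nonempty V := ⟨a⟩
  exact ⟨fun x y => (key _ x rfl).trans (key _ y rfl).symm⟩

end SimpleGraph

/-- Adjacency lists of a `(4;4,5)`-cage. -/
def cageNeighbors : Fin 18 → List (Fin 18) :=
  ![[1, 2, 3, 4], [0, 5, 7, 8], [0, 5, 7, 8], [0, 6, 7, 8], [0, 6, 7, 8],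
    [1, 2, 6, 14], [3, 4, 5, 15], [1, 2, 3, 4], [1, 2, 3, 4],
    [10, 11, 12, 13], [9, 14, 16, 17], [9, 14, 16, 17], [9, 15, 16, 17], [9, 15, 16, 17],
    [10, 11, 15, 5], [12, 13, 14, 6], [10, 11, 12, 13], [10, 11, 12, 13]]

/-- A `(4;4,5)`-cage that is `2`-connected and not bipartite. -/
def cage : SimpleGraph (Fin 18) where
  Adj x y := y ∈ cageNeighbors x
  symm := ⟨by decide +kernel⟩
  loopless := ⟨by decide +kernel⟩

instance : DecidableRel cage.Adj := fun x y =>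
  inferInstanceAs (Decidable (y ∈ cageNeighbors x))

namespace cage

theorem degree_eq (x : Fin 18) : cage.degree x = 4 := by
  revert x
  decide +kernel

theorem egirth_eq : cage.egirth = 4 := by
  refine le_antisymm ?_ (SimpleGraph.four_le_egirth_of_triangle_free (by decide +kernel))
  have h₁ : cage.Adj 0 1 := by decide
  have h₂ : cage.Adj 1 7 := by decide
  have h₃ : cage.Adj 7 2 := by decide
  have h₄ : cage.Adj 2 0 := by decide
  have hw : (SimpleGraph.Walk.cons h₁ (.cons h₂ (.cons h₃ (.cons h₄ .nil)))).IsCycle := by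
    simp [SimpleGraph.Walk.isCycle_def, SimpleGraph.Walk.isTrail_def]
  exact SimpleGraph.egirth_le_length hw

/-- The distance from the vertex `0`. -/
def level : Fin 18 → ℕ := ![0, 1, 1, 1, 1, 2, 2, 2, 2, 5, 4, 4, 4, 4, 3, 3, 3, 3]

theorem level_le {x y : Fin 18} (w : cage.Walk x y) : level y ≤ level x + w.length := by
  have hadj : ∀ x y, cage.Adj x y → level y ≤ level x + 1 := by decide +kernel
  induction w with
  | nil => simp
  | cons h w ih =>
    have := hadj _ _ h
    rw [SimpleGraph.Walk.length_cons]
    omega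

theorem ediam_eq : cage.ediam = 5 := by
  refine le_antisymm (SimpleGraph.ediam_le_of_edist_le fun x y => ?_) ?_
  · have hub : ∀ x, ∃ h, (h = 5 ∨ h = 14) ∧ (x = h ∨ cage.Adj x h ∨
        ∃ z, cage.Adj x z ∧ cage.Adj z h) := by decide +kernel
    have near : ∀ x, ∃ h, (h = 5 ∨ h = 14) ∧ cage.edist x h ≤ 2 := by
      intro x
      obtain ⟨h, hh, rfl | hx | ⟨z, hxz, hzh⟩⟩ := hub x
      · exact ⟨x, hh, by simp⟩
      · exact ⟨h, hh, (SimpleGraph.edist_eq_one_iff_adj.2 hx).le.trans (by decide)⟩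
      · exact ⟨h, hh, SimpleGraph.edist_le (.cons hxz (.cons hzh .nil))⟩
    obtain ⟨h, hh, hx⟩ := near x
    obtain ⟨h', hh', hy⟩ := near y
    have hmid : cage.edist h h' ≤ 1 := by
      rw [SimpleGraph.edist_le_one_iff_adj_or_eq]
      rcases hh with rfl | rfl <;> rcases hh' with rfl | rfl <;> decide
    calc cage.edist x y ≤ cage.edist x h + (cage.edist h h' + cage.edist h' y) :=
          SimpleGraph.edist_triangle.trans (add_le_add le_rfl SimpleGraph.edist_triangle)
      _ ≤ 2 + (1 + 2) := add_le_add hx (add_le_add hmid (SimpleGraph.edist_comm.trans_le hy))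
      _ = 5 := by norm_num
  · refine le_trans ?_ (SimpleGraph.edist_le_ediam (u := 0) (v := 9))
    rw [SimpleGraph.edist_eq_sInf]
    refine le_sInf ?_
    rintro _ ⟨w, rfl⟩
    have h : 5 ≤ 0 + w.length := level_le w
    exact Nat.cast_le.2 (by omega : 5 ≤ w.length)

/-- The root of a breadth-first search tree of `cage` with the vertex `w` deleted. -/
def root (w : Fin 18) : Fin 18 := if w = 5 ∨ w = 14 then 6 else 5

/-- The depth in a breadth-first search tree of `cage` with the vertex `w` deleted. -/
def rank (w : Fin 18) : Fin 18 → ℕ :=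
  if w = 5 ∨ w = 14 then ![2, 3, 3, 1, 1, 1, 0, 2, 2, 3, 4, 4, 2, 2, 2, 1, 3, 3]
  else ![2, 1, 1, 3, 3, 0, 1, 2, 2, 3, 2, 2, 4, 4, 1, 2, 3, 3]

theorem connected_induce_ne (w : Fin 18) :
    (SimpleGraph.induce {x : Fin 18 | x ≠ w} cage).Connected := by
  have hroot : ∀ w, root w ≠ w := by decide +kernel
  have hrank : ∀ w x, x ≠ w → x ≠ root w → ∃ y, y ≠ w ∧ cage.Adj x y ∧ rank w y < rank w x := by
    decide +kernel
  refine SimpleGraph.connected_of_rank ⟨root w, hroot w⟩ (fun x => rank w x) ?_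
  rintro ⟨x, hx⟩ hne
  obtain ⟨y, hy, hxy, hlt⟩ := hrank w x hx fun h => hne (Subtype.ext h)
  exact ⟨⟨y, hy⟩, hxy, hlt⟩

theorem not_colorable_two : ¬ cage.Colorable 2 := by
  rintro ⟨c⟩
  have h₁ := c.valid (show cage.Adj 0 1 by decide)
  have h₂ := c.valid (show cage.Adj 1 5 by decide)
  have h₃ := c.valid (show cage.Adj 5 6 by decide)
  have h₄ := c.valid (show cage.Adj 6 3 by decide)
  have h₅ := c.valid (show cage.Adj 3 0 by decide)
  omega

end cage

theorem minOrder_four_four_five :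
    (∃ G : SimpleGraph (Fin 18), IsKGDGraph 4 4 5 G ∧ G.Connected ∧
      (∀ v : Fin 18, (SimpleGraph.induce {w : Fin 18 | w ≠ v} G).Connected) ∧
      ¬ G.Colorable 2) ∧
    ∀ {V : Type} [Fintype V] (G : SimpleGraph V), IsKGDGraph 4 4 5 G →
      18 ≤ Fintype.card V := by
  classical
  refine ⟨⟨cage, ⟨fun v => ?_, cage.egirth_eq, cage.ediam_eq⟩, ?_, cage.connected_induce_ne,
    cage.not_colorable_two⟩, ?_⟩
  · rw [SimpleGraph.ncard_neighborSet, cage.degree_eq]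
  · exact SimpleGraph.connected_of_ediam_ne_top (by rw [cage.ediam_eq]; decide)
  · rintro V _ G ⟨hreg, hgirth, hdiam⟩
    refine SimpleGraph.four_mul_add_two_le_card_of_ediam_eq_five (k := 4) (fun x => ?_)
      hgirth.ge hdiam
    rw [← hreg x, SimpleGraph.ncard_neighborSet]
end
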